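/- Existence of near-linear-size hypergraph spectral sparsifiers: There exists a universal constant C > 0 such that for every weighted hypergraph H = (V, E, w) with |V| = n ≥ 2, rank r ≥ 2, and nonnegative weights, and every ε ∈ (0,1), there exists an ε-spectral sparsifier H̃ = (V, Ẽ, w̃) of H with |Ẽ| ≤ C·n·log n·log r / ε². -/

import Mathlib

open Matrix BigOperators

/-- The vector `δ_i - δ_j` in `ℝ^n`. -/
noncomputable def dvec {n : ℕ} (i j : Fin n) : Fin n → ℝ :=
  fun k => (if k = i then (1 : ℝ) else 0) - (if k = j then (1 : ℝ) else 0)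

/-- The rank-one matrix `(δ_i - δ_j)(δ_i - δ_j)ᵀ`, as a function of the unordered pair `{i,j}`. -/
noncomputable def edgeMat {n : ℕ} : Sym2 (Fin n) → Matrix (Fin n) (Fin n) ℝ :=
  Sym2.lift ⟨fun i j => Matrix.vecMulVec (dvec i j) (dvec i j), by
    intro i j
    ext a b
    simp [Matrix.vecMulVec_apply, dvec]
    ring⟩

/-- `M` is the Moore–Penrose pseudoinverse of `L` (the four Penrose equations). -/
def IsMP {n : ℕ} (L M : Matrix (Fin n) (Fin n) ℝ) : Prop :=
  L * M * L = L ∧ M * L * M = M ∧ (L * M)ᵀ = L * M ∧ (M * L)ᵀ = M * L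

/-- The Moore–Penrose pseudoinverse (chosen via the Penrose equations, which determine
it uniquely whenever it exists). -/
noncomputable def pinv {n : ℕ} (L : Matrix (Fin n) (Fin n) ℝ) : Matrix (Fin n) (Fin n) ℝ :=
  haveI := Classical.propDecidable (∃ M, IsMP L M)
  if h : ∃ M, IsMP L M then h.choose else 0

/-- Effective resistance `(δ_i - δ_j)ᵀ L⁺ (δ_i - δ_j)` of an unordered pair, given `L⁺`. -/
noncomputable def res {n : ℕ} (Lp : Matrix (Fin n) (Fin n) ℝ) : Sym2 (Fin n) → ℝ :=
  Sym2.lift ⟨fun i j => dvec i j ⬝ᵥ (Lp *ᵥ dvec i j), by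
    intro i j
    show dvec i j ⬝ᵥ (Lp *ᵥ dvec i j) = dvec j i ⬝ᵥ (Lp *ᵥ dvec j i)
    have h : dvec j i = -(dvec i j) := by
      funext k; simp [dvec, Pi.neg_apply]
    rw [h]
    simp [Matrix.mulVec_neg]⟩

/-- Laplacian of the weighted graph with edge set `F` and weights `c`. -/
noncomputable def lapG {n : ℕ} (F : Finset (Sym2 (Fin n))) (c : Sym2 (Fin n) → ℝ) :
    Matrix (Fin n) (Fin n) ℝ :=
  ∑ f ∈ F, c f • edgeMat f

/-- The unordered pairs of distinct vertices contained in `e`. -/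
def pairs {n : ℕ} (e : Finset (Fin n)) : Finset (Sym2 (Fin n)) :=
  e.sym2.filter fun f => ¬ f.IsDiag

/-- `Q_e(x) = max_{{i,j} ⊆ e} (x_i - x_j)²`. -/
noncomputable def Qe {n : ℕ} (x : Fin n → ℝ) (e : Finset (Fin n)) : ℝ :=
  ⨆ i ∈ e, ⨆ j ∈ e, (x i - x j) ^ 2

/-- The hypergraph energy `Q_H(x) = Σ_e w_e Q_e(x)`. -/
noncomputable def QH {n : ℕ} (E : Finset (Finset (Fin n))) (w : Finset (Fin n) → ℝ)
    (x : Fin n → ℝ) : ℝ :=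
  ∑ e ∈ E, w e * Qe x e

/-- Laplacian of the underlying (multi)graph of a hypergraph with weights `c e f`. -/
noncomputable def lapU {n : ℕ} (E : Finset (Finset (Fin n)))
    (c : Finset (Fin n) → Sym2 (Fin n) → ℝ) : Matrix (Fin n) (Fin n) ℝ :=
  ∑ e ∈ E, ∑ f ∈ pairs e, c e f • edgeMat f

section GaussianWeight

open MeasureTheory

lemma measurable_gaussWeight {V : Type*} [NormedAddCommGroup V] [MeasurableSpace V]
    [BorelSpace V] : Measurable fun x : V => ENNReal.ofReal (Real.exp (-‖x‖ ^ 2 / 2)) := by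
  fun_prop

variable {V : Type*} [NormedAddCommGroup V] [InnerProductSpace ℝ V] [FiniteDimensional ℝ V]
  [MeasurableSpace V] [BorelSpace V]

/-- The unnormalised standard Gaussian measure on a Euclidean space. -/
noncomputable def gaussMeasure (V : Type*) [NormedAddCommGroup V] [InnerProductSpace ℝ V]
    [FiniteDimensional ℝ V] [MeasurableSpace V] [BorelSpace V] : Measure V :=
  volume.withDensity fun x => ENNReal.ofReal (Real.exp (-‖x‖ ^ 2 / 2))

/-- The mean of `f` under the normalised standard Gaussian measure is at most `M`. -/
def GaussMeanLE (f : V → ℝ) (M : ℝ) : Prop :=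
  ∫⁻ x, ENNReal.ofReal (f x) ∂gaussMeasure V ≤ ENNReal.ofReal M * gaussMeasure V Set.univ

lemma gaussMeasure_univ_ne_top : gaussMeasure V Set.univ ≠ ⊤ := by
  have h : Integrable (fun x : V => Real.exp (-‖x‖ ^ 2 / 2)) volume := by
    have h1 := (GaussianFourier.integrable_cexp_neg_mul_sq_norm_add (V := V) (b := (1 / 2 : ℂ))
      (by norm_num) 0 0).norm
    refine h1.congr (Filter.Eventually.of_forall fun x => ?_)
    simp only [Complex.norm_exp]
    congr 1
    simp only [zero_mul, add_zero]
    have : (-(1 / 2 : ℂ) * (‖x‖ : ℂ) ^ 2) = ((-‖x‖ ^ 2 / 2 : ℝ) : ℂ) := by push_cast; ring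
    rw [this, Complex.ofReal_re]
  rw [gaussMeasure, withDensity_apply _ MeasurableSet.univ, Measure.restrict_univ]
  exact h.lintegral_lt_top.ne

lemma gaussMeasure_univ_ne_zero : gaussMeasure V Set.univ ≠ 0 := by
  rw [gaussMeasure, withDensity_apply _ MeasurableSet.univ, Measure.restrict_univ]
  intro h
  rw [lintegral_eq_zero_iff measurable_gaussWeight] at h
  have h2 : ∀ᵐ _ : V, False := by
    filter_upwards [h] with x hx
    have : ENNReal.ofReal (Real.exp (-‖x‖ ^ 2 / 2)) = 0 := hx
    rw [ENNReal.ofReal_eq_zero] at this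
    exact absurd (Real.exp_pos _) (not_lt.mpr this)
  rw [ae_iff] at h2
  simp at h2
  exact NeZero.ne (volume : Measure V) h2

lemma lintegral_gaussMeasure (f : V → ENNReal) (hf : Measurable f) :
    ∫⁻ x, f x ∂gaussMeasure V =
      ∫⁻ x, ENNReal.ofReal (Real.exp (-‖x‖ ^ 2 / 2)) * f x := by
  rw [gaussMeasure, lintegral_withDensity_eq_lintegral_mul _ measurable_gaussWeight hf]
  rfl

lemma lintegral_exp_inner (a : V) :
    ∫⁻ x, ENNReal.ofReal (Real.exp (inner ℝ a x)) ∂gaussMeasure V =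
      ENNReal.ofReal (Real.exp (‖a‖ ^ 2 / 2)) * gaussMeasure V Set.univ := by
  rw [lintegral_gaussMeasure _ (by fun_prop), gaussMeasure,
    withDensity_apply _ MeasurableSet.univ, Measure.restrict_univ,
    ← lintegral_const_mul _ measurable_gaussWeight,
    ← lintegral_add_right_eq_self
      (fun x : V => ENNReal.ofReal (Real.exp (‖a‖ ^ 2 / 2)) *
        ENNReal.ofReal (Real.exp (-‖x‖ ^ 2 / 2))) (-a)]
  refine lintegral_congr fun x => ?_
  rw [← ENNReal.ofReal_mul (Real.exp_nonneg _), ← ENNReal.ofReal_mul (Real.exp_nonneg _),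
    ← Real.exp_add, ← Real.exp_add, ← sub_eq_add_neg, @norm_sub_sq ℝ, real_inner_comm]
  congr 2
  simp
  ring

/-- Shifting a symmetric set by `y` shrinks its Gaussian measure by at most `exp (-‖y‖² / 2)`. -/
lemma gaussMeasure_translate (A : Set V) (hA : MeasurableSet A) (hsymm : ∀ x, -x ∈ A ↔ x ∈ A)
    (y : V) :
    ENNReal.ofReal (Real.exp (-‖y‖ ^ 2 / 2)) * gaussMeasure V A ≤
      gaussMeasure V {x | x - y ∈ A} := by
  classical
  have hm : MeasurableSet {x : V | x - y ∈ A} := (measurable_id.sub_const y) hA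
  set W : V → ENNReal := fun x => ENNReal.ofReal (Real.exp (-‖x‖ ^ 2 / 2)) with hW
  set I : V → ENNReal := A.indicator 1 with hI
  have hIm : Measurable I := measurable_one.indicator hA
  have hWm : Measurable W := measurable_gaussWeight
  have hIW : Measurable fun x => I x * W x := hIm.mul hWm
  have hIW' : Measurable fun x => I x * W (x + y) :=
    hIm.mul (hWm.comp (measurable_id.add_const y))
  have e0 : gaussMeasure V {x | x - y ∈ A} = ∫⁻ x, I (x - y) * W x := by
    rw [gaussMeasure, withDensity_apply _ hm, ← lintegral_indicator hm]
    refine lintegral_congr fun x => ?_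
    by_cases hx : x - y ∈ A <;> simp [hI, hx, Set.indicator, hW]
  have e1 : gaussMeasure V {x | x - y ∈ A} = ∫⁻ x, I x * W (x + y) := by
    rw [e0, ← lintegral_add_right_eq_self (fun x => I (x - y) * W x) y]
    simp
  have e2 : gaussMeasure V {x | x - y ∈ A} = ∫⁻ x, I x * W (-x + y) := by
    rw [e1, ← lintegral_neg_eq_self]
    refine lintegral_congr fun x => ?_
    have : I (-x) = I x := by
      by_cases hx : x ∈ A
      · simp [hI, hx, (hsymm x).2 hx]
      · simp [hI, hx, mt (hsymm x).1 hx]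
    rw [this]
  have e3 : gaussMeasure V A = ∫⁻ x, I x * W x := by
    rw [gaussMeasure, withDensity_apply _ hA, ← lintegral_indicator hA]
    refine lintegral_congr fun x => ?_
    by_cases hx : x ∈ A <;> simp [hI, hx, hW]
  have key : 2 * (ENNReal.ofReal (Real.exp (-‖y‖ ^ 2 / 2)) * gaussMeasure V A) ≤
      2 * gaussMeasure V {x | x - y ∈ A} := by
    calc 2 * (ENNReal.ofReal (Real.exp (-‖y‖ ^ 2 / 2)) * gaussMeasure V A)
        = ∫⁻ x, I x * (2 * (ENNReal.ofReal (Real.exp (-‖y‖ ^ 2 / 2)) * W x)) := by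
          rw [e3, ← lintegral_const_mul _ hIW,
            ← lintegral_const_mul _ (hIW.const_mul _)]
          refine lintegral_congr fun x => ?_
          ring
      _ ≤ ∫⁻ x, (I x * W (x + y) + I x * W (-x + y)) := by
          refine lintegral_mono fun x => ?_
          simp only
          rw [← mul_add]
          gcongr
          simp only [hW]
          rw [← ENNReal.ofReal_mul (Real.exp_nonneg _), ← ENNReal.ofReal_add (Real.exp_nonneg _)
            (Real.exp_nonneg _), ← Real.exp_add, show (2 : ENNReal) = ENNReal.ofReal 2 by simp,
            ← ENNReal.ofReal_mul (by norm_num)]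
          apply ENNReal.ofReal_le_ofReal
          have h1 : -‖x + y‖ ^ 2 / 2 = (-‖y‖ ^ 2 / 2 + -‖x‖ ^ 2 / 2) + -(inner ℝ x y) := by
            rw [@norm_add_sq ℝ]; simp; ring
          have h2 : -‖-x + y‖ ^ 2 / 2 = (-‖y‖ ^ 2 / 2 + -‖x‖ ^ 2 / 2) + (inner ℝ x y) := by
            rw [@norm_add_sq ℝ]; simp; ring
          rw [h1, h2, Real.exp_add _ (-(inner ℝ x y)), Real.exp_add _ (inner ℝ x y)]
          have h3 := Real.one_le_cosh (inner ℝ x y)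
          rw [Real.cosh_eq] at h3
          nlinarith [Real.exp_pos (-‖y‖ ^ 2 / 2 + -‖x‖ ^ 2 / 2)]
      _ = 2 * gaussMeasure V {x | x - y ∈ A} := by
          rw [lintegral_add_left hIW',
            ← e1, ← e2, two_mul]
  exact (ENNReal.mul_le_mul_iff_right (by norm_num) (by norm_num)).1 key

lemma GaussMeanLE.mono {f g : V → ℝ} {M N : ℝ} (h : GaussMeanLE f M) (hfg : ∀ x, g x ≤ f x)
    (hMN : M ≤ N) : GaussMeanLE g N := by
  unfold GaussMeanLE at *
  calc _ ≤ ∫⁻ x, ENNReal.ofReal (f x) ∂gaussMeasure V :=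
        lintegral_mono fun x => ENNReal.ofReal_le_ofReal (hfg x)
    _ ≤ _ := h
    _ ≤ _ := by gcongr

lemma GaussMeanLE.add {f g : V → ℝ} {M N : ℝ} (hf : GaussMeanLE f M) (hg : GaussMeanLE g N)
    (hM : 0 ≤ M) (hN : 0 ≤ N) (hfm : Measurable f) :
    GaussMeanLE (fun x => f x + g x) (M + N) := by
  unfold GaussMeanLE at *
  calc _ ≤ ∫⁻ x, (ENNReal.ofReal (f x) + ENNReal.ofReal (g x)) ∂gaussMeasure V :=
        lintegral_mono fun x => ENNReal.ofReal_add_le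
    _ = _ := lintegral_add_left hfm.ennreal_ofReal _
    _ ≤ _ := add_le_add hf hg
    _ = _ := by rw [ENNReal.ofReal_add hM hN, add_mul]

lemma GaussMeanLE.const_mul {f : V → ℝ} {M c : ℝ} (hf : GaussMeanLE f M) (hc : 0 ≤ c) :
    GaussMeanLE (fun x => c * f x) (c * M) := by
  unfold GaussMeanLE at *
  simp_rw [ENNReal.ofReal_mul hc]
  rw [lintegral_const_mul' _ _ ENNReal.ofReal_ne_top, mul_assoc]
  gcongr

lemma GaussMeanLE.const (c : ℝ) : GaussMeanLE (fun _ : V => c) c := by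
  simp [GaussMeanLE]

lemma GaussMeanLE.sum {ι : Type*} (s : Finset ι) {f : ι → V → ℝ} {M : ι → ℝ}
    (hf : ∀ i ∈ s, GaussMeanLE (f i) (M i)) (hM : ∀ i ∈ s, 0 ≤ M i)
    (hfm : ∀ i ∈ s, Measurable (f i)) :
    GaussMeanLE (fun x => ∑ i ∈ s, f i x) (∑ i ∈ s, M i) := by
  classical
  induction s using Finset.induction_on with
  | empty => simpa using GaussMeanLE.const (V := V) 0
  | insert a s ha ih =>
    simp only [Finset.mem_insert, forall_eq_or_imp] at hf hM hfm
    simp only [Finset.sum_insert ha]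
    exact hf.1.add (ih hf.2 hM.2 hfm.2) hM.1 (Finset.sum_nonneg hM.2) hfm.1

lemma gaussMeanLE_exp_inner (a : V) :
    GaussMeanLE (fun x => Real.exp (inner ℝ a x)) (Real.exp (‖a‖ ^ 2 / 2)) :=
  (lintegral_exp_inner a).le

lemma gaussMeanLE_exp_abs_inner (a : V) :
    GaussMeanLE (fun x => Real.exp |inner ℝ a x|) (2 * Real.exp (‖a‖ ^ 2 / 2)) := by
  have h := (gaussMeanLE_exp_inner a).add (gaussMeanLE_exp_inner (-a)) (Real.exp_nonneg _)
    (Real.exp_nonneg _) (by fun_prop)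
  refine h.mono (fun x => ?_) (by simp; linarith)
  simp only [inner_neg_left]
  rcases abs_cases (inner ℝ a x) with h | h <;> rw [h.1] <;>
    linarith [Real.exp_pos (inner ℝ a x), Real.exp_pos (-inner ℝ a x)]

lemma sq_le_exp_sub (L z : ℝ) (hz : 0 ≤ z) (hL : 0 ≤ L) :
    z ^ 2 ≤ 8 * L ^ 2 + 4 * Real.exp (z - 2 * L) := by
  by_cases h : z ≤ 2 * L
  · nlinarith [Real.exp_pos (z - 2 * L)]
  · push Not at h
    have := Real.quadratic_le_exp_of_nonneg (x := z - 2 * L) (by linarith)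
    nlinarith [sq_nonneg (z - 4 * L)]

/-- The second moment of the maximum of `R` Gaussians of variance at most `δ` is `O(δ log R)`. -/
lemma gaussMeanLE_sup_sq {κ : Type*} (S : Finset κ) (a : κ → V) {δ R : ℝ} (hδ : 0 < δ)
    (hR : 2 ≤ R) (hS : (S.card : ℝ) ≤ R) (ha : ∀ i ∈ S, ‖a i‖ ^ 2 ≤ δ) (p : V → ℝ)
    (hp : ∀ x, p x = 0 ∨ ∃ i ∈ S, p x = |inner ℝ (a i) x|) :
    GaussMeanLE (fun x => p x ^ 2) (16 * δ * Real.log R) := by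
  set L := Real.log R with hL
  have hL2 : (2 / 3 : ℝ) ≤ L := by
    have := Real.log_le_log (by norm_num) hR
    linarith [Real.log_two_gt_d9]
  set l := Real.sqrt (2 * L / δ) with hl
  have hl2 : l ^ 2 = 2 * L / δ := Real.sq_sqrt (by positivity)
  have hlpos : 0 < l := Real.sqrt_pos.2 (by positivity)
  have hexpL : Real.exp L = R := Real.exp_log (by linarith)
  have h1 : GaussMeanLE (fun x => 8 * L ^ 2 + 4 * Real.exp (-2 * L) *
      ∑ i ∈ S, Real.exp |inner ℝ (l • a i) x|)
      (8 * L ^ 2 + 4 * Real.exp (-2 * L) * ∑ i ∈ S, 2 * Real.exp (‖l • a i‖ ^ 2 / 2)) := by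
    refine (GaussMeanLE.const _).add ?_ (by positivity) (by positivity) (by fun_prop)
    refine GaussMeanLE.const_mul ?_ (by positivity)
    exact GaussMeanLE.sum S (fun i _ => gaussMeanLE_exp_abs_inner _) (fun i _ => by positivity)
      (fun i _ => by fun_prop)
  refine (h1.const_mul (c := (l ^ 2)⁻¹) (by positivity)).mono (fun x => ?_) ?_
  · rw [← div_eq_inv_mul, le_div_iff₀ (by positivity)]
    have hpos : ∀ i ∈ S, 0 ≤ Real.exp |inner ℝ (l • a i) x| := fun i _ => by positivity
    rcases hp x with h | ⟨i, hi, h⟩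
    · rw [h]
      have := Finset.sum_nonneg hpos
      rw [zero_pow two_ne_zero, zero_mul]
      positivity
    · have h3 := sq_le_exp_sub L (l * |inner ℝ (a i) x|) (by positivity) (by linarith)
      have h4 : |inner ℝ (l • a i) x| = l * |inner ℝ (a i) x| := by
        rw [real_inner_smul_left, abs_mul, abs_of_pos hlpos]
      have h5 := Finset.single_le_sum hpos hi
      rw [h4] at h5
      rw [h]
      have h6 : Real.exp (l * |inner ℝ (a i) x| - 2 * L) =
          Real.exp (-2 * L) * Real.exp (l * |inner ℝ (a i) x|) := by
        rw [← Real.exp_add]; congr 1; ring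
      rw [h6] at h3
      nlinarith [mul_le_mul_of_nonneg_left h5 (Real.exp_nonneg (-2 * L))]
  · rw [← div_eq_inv_mul, div_le_iff₀ (by positivity), hl2]
    have h7 : ∑ i ∈ S, 2 * Real.exp (‖l • a i‖ ^ 2 / 2) ≤ R * (2 * R) := by
      calc _ ≤ ∑ i ∈ S, 2 * R := by
            refine Finset.sum_le_sum fun i hi => ?_
            rw [← hexpL]
            gcongr
            rw [norm_smul, mul_pow, Real.norm_eq_abs, sq_abs, hl2]
            have := mul_le_mul_of_nonneg_left (ha i hi) (show 0 ≤ 2 * L / δ by positivity)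
            rw [div_mul_cancel₀ _ hδ.ne'] at this
            linarith
        _ = S.card * (2 * R) := by simp
        _ ≤ _ := by gcongr
    have h8 : Real.exp (-2 * L) = (R * R)⁻¹ := by
      rw [← hexpL, ← Real.exp_add, ← Real.exp_neg]; congr 1; ring
    have h9 : 4 * Real.exp (-2 * L) * ∑ i ∈ S, 2 * Real.exp (‖l • a i‖ ^ 2 / 2) ≤ 8 := by
      calc _ ≤ 4 * Real.exp (-2 * L) * (R * (2 * R)) := by gcongr
        _ = 8 := by rw [h8]; field_simp; norm_num
    have h10 : 16 * δ * L * (2 * L / δ) = 32 * L ^ 2 := by field_simp; norm_num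
    rw [h10]
    nlinarith

lemma gaussMeanLE_norm_sq : GaussMeanLE (fun x : V => ‖x‖ ^ 2) (16 * Module.finrank ℝ V) := by
  set b := stdOrthonormalBasis ℝ V
  have h : ∀ i ∈ Finset.univ, GaussMeanLE (fun x : V => (inner ℝ (b i) x) ^ 2) (16 : ℝ) := by
    intro i _
    have h := gaussMeanLE_sup_sq {i} (fun i => b i) (δ := 1) (R := 2) one_pos le_rfl (by simp)
      (by intro j _; rw [b.orthonormal.1 j]; norm_num) (fun x => |inner ℝ (b i) x|)
      (fun x => Or.inr ⟨i, by simp, rfl⟩)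
    refine h.mono (fun x => by simp) ?_
    linarith [Real.log_two_lt_d9]
  have h2 := GaussMeanLE.sum Finset.univ h (fun i _ => by norm_num) (fun i _ => by fun_prop)
  refine h2.mono (fun x => ?_) (by simp; linarith)
  rw [← b.sum_sq_norm_inner_right x]
  simp

/-- Volume packing in Gaussian space: a centred ball of squared radius `b` can be labelled by
`O(exp (b / 2s²))` labels such that equally labelled points are `O(s²)`-close in any
homogeneous quadratic gauge of bounded Gaussian mean. -/
lemma exists_gaussian_label {Q : V → ℝ} (hQm : Measurable Q)
    (hneg : ∀ x, Q (-x) = Q x) (hadd : ∀ x y, Q (x + y) ≤ 2 * Q x + 2 * Q y)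
    (hsmul : ∀ (c : ℝ) x, Q (c • x) = c ^ 2 * Q x) {M : ℝ} (hM : 0 < M)
    (hQM : GaussMeanLE Q M) {b s : ℝ} (hs : 0 < s) :
    ∃ ℓ : V → ℕ, (∀ h, ‖h‖ ^ 2 ≤ b → (ℓ h : ℝ) + 1 ≤ 2 * Real.exp (b / (2 * s ^ 2))) ∧
      ∀ h h', ‖h‖ ^ 2 ≤ b → ‖h'‖ ^ 2 ≤ b → ℓ h = ℓ h' → Q (h - h') ≤ 32 * s ^ 2 * M := by
  classical
  set A : Set V := {x | Q x ≤ 2 * M} with hA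
  have hAm : MeasurableSet A := measurableSet_le hQm measurable_const
  have hAs : ∀ x, -x ∈ A ↔ x ∈ A := fun x => by simp [hA, hneg]
  set Z := gaussMeasure V Set.univ with hZ
  have hZt : Z ≠ ⊤ := gaussMeasure_univ_ne_top
  have hZ0 : Z ≠ 0 := gaussMeasure_univ_ne_zero
  have hAc : gaussMeasure V Aᶜ ≤ Z / 2 := by
    have h1 := mul_meas_ge_le_lintegral₀ (μ := gaussMeasure V) (f := fun x => ENNReal.ofReal (Q x))
      hQm.ennreal_ofReal.aemeasurable (ENNReal.ofReal (2 * M))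
    have h2 : gaussMeasure V Aᶜ ≤
        gaussMeasure V {x | ENNReal.ofReal (2 * M) ≤ ENNReal.ofReal (Q x)} := by
      refine measure_mono fun x hx => ?_
      simp only [hA, Set.mem_compl_iff, Set.mem_ofPred_eq, not_le] at hx
      exact ENNReal.ofReal_le_ofReal hx.le
    have h3 : ENNReal.ofReal (2 * M) * gaussMeasure V Aᶜ ≤ ENNReal.ofReal M * Z :=
      ((mul_le_mul_right h2 _).trans h1).trans hQM
    rw [ENNReal.le_div_iff_mul_le (by simp) (by simp), mul_comm]
    have hM0 : ENNReal.ofReal M ≠ 0 := by simpa using hM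
    rw [ENNReal.ofReal_mul (by norm_num), mul_comm (ENNReal.ofReal 2), mul_assoc] at h3
    simpa using (ENNReal.mul_le_mul_iff_right hM0 ENNReal.ofReal_ne_top).1 h3
  have hAZ : Z / 2 ≤ gaussMeasure V A := by
    have h1 : Z ≤ gaussMeasure V A + gaussMeasure V Aᶜ := by
      rw [hZ, ← Set.union_compl_self A]; exact measure_union_le _ _
    have h2 : Z / 2 + Z / 2 ≤ gaussMeasure V A + Z / 2 := by
      rw [ENNReal.add_halves]; exact h1.trans (by gcongr)
    exact (ENNReal.add_le_add_iff_right (ENNReal.div_lt_top hZt (by norm_num)).ne).1 h2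
  set T : V → Set V := fun y => {x | x - s⁻¹ • y ∈ A} with hT
  set E := Real.exp (b / (2 * s ^ 2)) with hE
  have hTm : ∀ y, MeasurableSet (T y) := fun y => (measurable_id.sub_const _) hAm
  let Pack : Finset V → Prop := fun Y =>
    (∀ y ∈ Y, ‖y‖ ^ 2 ≤ b) ∧ (Y : Set V).Pairwise (Function.onFun Disjoint T)
  have hcard : ∀ Y, Pack Y → (Y.card : ℝ) ≤ 2 * E := by
    intro Y hY
    have h1 := sum_measure_le_measure_univ (μ := gaussMeasure V) (s := Y) (t := T)
      (fun y _ => (hTm y).nullMeasurableSet) (fun x hx y hy hxy => (hY.2 hx hy hxy).aedisjoint)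
    have h2 : ∀ y ∈ Y, ENNReal.ofReal E⁻¹ * (Z / 2) ≤ gaussMeasure V (T y) := by
      intro y hy
      refine le_trans ?_ (gaussMeasure_translate A hAm hAs _)
      gcongr
      rw [hE, ← Real.exp_neg, norm_smul, mul_pow, norm_inv, inv_pow, Real.norm_eq_abs, sq_abs]
      gcongr
      have h3 := hY.1 y hy
      rw [neg_div, neg_le_neg_iff]
      calc (s ^ 2)⁻¹ * ‖y‖ ^ 2 / 2 ≤ (s ^ 2)⁻¹ * b / 2 := by gcongr
        _ = _ := by field_simp
    have h3 : (Y.card : ENNReal) * (ENNReal.ofReal E⁻¹ * (Z / 2)) ≤ Z := by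
      refine le_trans ?_ h1
      rw [← nsmul_eq_mul, ← Finset.sum_const]
      exact Finset.sum_le_sum h2
    have hEpos : 0 < E := Real.exp_pos _
    have h4 := ENNReal.toReal_mono hZt h3
    simp only [ENNReal.toReal_mul, ENNReal.toReal_natCast, ENNReal.toReal_div,
      ENNReal.toReal_ofNat, ENNReal.toReal_ofReal (inv_nonneg.2 hEpos.le)] at h4
    have hZr : 0 < Z.toReal := ENNReal.toReal_pos hZ0 hZt
    have h5 : (Y.card : ℝ) * (E⁻¹ * (Z.toReal / 2)) = (Y.card * E⁻¹ / 2) * Z.toReal := by ring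
    rw [h5] at h4
    have h6 : (Y.card : ℝ) * E⁻¹ / 2 ≤ 1 := by
      by_contra hcon
      push Not at hcon
      nlinarith
    have h7 : (Y.card : ℝ) * E⁻¹ ≤ 2 := by linarith
    rw [← div_eq_mul_inv, div_le_iff₀ hEpos] at h7
    exact h7
  obtain ⟨Y, hYP, hYmax⟩ : ∃ Y, Pack Y ∧ ∀ Y', Pack Y' → Y'.card ≤ Y.card := by
    let P : ℕ → Prop := fun N => ∃ Y, Pack Y ∧ Y.card = N
    have hb : ∀ N, P N → N ≤ ⌊2 * E⌋₊ := by
      rintro N ⟨Y, hY, rfl⟩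
      exact Nat.le_floor (hcard Y hY)
    have h0 : P 0 := ⟨∅, ⟨by simp, by simp⟩, rfl⟩
    obtain ⟨Y, hY, hYc⟩ := Nat.findGreatest_spec (P := P) (Nat.zero_le ⌊2 * E⌋₊) h0
    refine ⟨Y, hY, fun Y' hY' => ?_⟩
    rw [hYc]
    exact Nat.le_findGreatest (hb _ ⟨Y', hY', rfl⟩) ⟨Y', hY', rfl⟩
  have hnear : ∀ h, ‖h‖ ^ 2 ≤ b → ∃ y : Y, Q (h - y) ≤ 8 * s ^ 2 * M := by
    intro h hh
    by_cases hhY : h ∈ Y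
    · refine ⟨⟨h, hhY⟩, ?_⟩
      have := hsmul 0 h
      simp at this
      simp [this]
      positivity
    · have h1 : ¬ Pack (insert h Y) := fun hcon => by
        have := hYmax _ hcon
        rw [Finset.card_insert_of_notMem hhY] at this
        omega
      have h2 : ∃ y ∈ Y, ¬ Disjoint (T h) (T y) := by
        by_contra hcon
        push Not at hcon
        apply h1
        refine ⟨by simpa using ⟨hh, hYP.1⟩, ?_⟩
        rw [Finset.coe_insert, Set.pairwise_insert]
        exact ⟨hYP.2, fun y hy _ => ⟨hcon y hy, (hcon y hy).symm⟩⟩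
      obtain ⟨y, hy, hd⟩ := h2
      obtain ⟨z, hz1, hz2⟩ := Set.not_disjoint_iff.1 hd
      refine ⟨⟨y, hy⟩, ?_⟩
      have e : h - y = s • ((z - s⁻¹ • y) + -(z - s⁻¹ • h)) := by
        rw [show (z - s⁻¹ • y) + -(z - s⁻¹ • h) = s⁻¹ • (h - y) by
          rw [smul_sub]; abel, smul_smul, mul_inv_cancel₀ hs.ne', one_smul]
      have h3 := hadd (z - s⁻¹ • y) (-(z - s⁻¹ • h))
      rw [hneg] at h3
      simp only [hT, hA, Set.mem_ofPred_eq] at hz1 hz2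
      simp only
      rw [e, hsmul]
      nlinarith [sq_nonneg s]
  choose c hc using hnear
  have hl : ∀ h (hh : ‖h‖ ^ 2 ≤ b),
      (if hh : ‖h‖ ^ 2 ≤ b then (Y.equivFin (c h hh) : ℕ) else 0) = Y.equivFin (c h hh) :=
    fun h hh => dif_pos hh
  refine ⟨fun h => if hh : ‖h‖ ^ 2 ≤ b then (Y.equivFin (c h hh) : ℕ) else 0,
    fun h hh => ?_, fun h h' hh hh' he => ?_⟩
  · beta_reduce
    rw [hl h hh]
    refine le_trans ?_ (hcard Y hYP)
    exact_mod_cast (Y.equivFin (c h hh)).2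
  · simp only [hl h hh, hl h' hh'] at he
    have e1 : c h hh = c h' hh' := Y.equivFin.injective (Fin.ext he)
    have h1 := hc h hh
    have h2 := hc h' hh'
    rw [← e1] at h2
    have h3 := hadd (h - c h hh) (-(h' - c h hh))
    rw [hneg, show (h - (c h hh : V)) + -(h' - c h hh) = h - h' by abel] at h3
    linarith

end GaussianWeight

section SquareFunctionGeometry

open MeasureTheory

variable {V : Type*} [NormedAddCommGroup V] [InnerProductSpace ℝ V]
  {ι : Type*} [Fintype ι]

/-- The sum of the squares of a finite family of seminorms. -/
noncomputable def energy (N : ι → Seminorm ℝ V) (v : V) : ℝ := ∑ i, N i v ^ 2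

/-- The squared norm plus the energy. -/
noncomputable def normEnergy (N : ι → Seminorm ℝ V) (v : V) : ℝ := ‖v‖ ^ 2 + energy N v

/-- A convex-in-`u` surrogate of `∑ i, (N i u ^ 2 - N i v ^ 2) ^ 2`. -/
noncomputable def quasiDist (N : ι → Seminorm ℝ V) (c : ℝ) (u v : V) : ℝ :=
  ∑ i, N i (u - v) ^ 2 * (N i v ^ 2 + N i (u - v) ^ 2) + c * ‖u - v‖ ^ 2

variable (N : ι → Seminorm ℝ V)

lemma energy_nonneg (v : V) : 0 ≤ energy N v := Finset.sum_nonneg fun _ _ => sq_nonneg _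

lemma quasiDist_self (c : ℝ) (v : V) : quasiDist N c v v = 0 := by
  simp [quasiDist]

lemma mul_norm_sq_le_quasiDist {c : ℝ} (u v : V) : c * ‖u - v‖ ^ 2 ≤ quasiDist N c u v := by
  have : 0 ≤ ∑ i, N i (u - v) ^ 2 * (N i v ^ 2 + N i (u - v) ^ 2) :=
    Finset.sum_nonneg fun _ _ => by positivity
  unfold quasiDist
  linarith

lemma quasiDist_symm_le {c : ℝ} (hc : 0 ≤ c) (u v : V) :
    quasiDist N c v u ≤ 3 * quasiDist N c u v := by
  unfold quasiDist
  rw [mul_add, Finset.mul_sum]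
  refine add_le_add (Finset.sum_le_sum fun i _ => ?_) ?_
  · rw [map_sub_rev (N i) v u]
    have h : N i u ≤ N i (u - v) + N i v := by simpa using map_add_le_add (N i) (u - v) v
    have h2 : N i u ^ 2 ≤ (N i (u - v) + N i v) ^ 2 := by gcongr
    have h3 : N i u ^ 2 + N i (u - v) ^ 2 ≤ 3 * (N i v ^ 2 + N i (u - v) ^ 2) := by
      nlinarith [sq_nonneg (N i (u - v) - N i v)]
    nlinarith [mul_le_mul_of_nonneg_left h3 (sq_nonneg (N i (u - v)))]
  · rw [norm_sub_rev]
    nlinarith [mul_nonneg hc (sq_nonneg ‖u - v‖)]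

lemma quasiDist_triangle {c : ℝ} (hc : 0 ≤ c) (u v w : V) :
    quasiDist N c u w ≤ 10 * (quasiDist N c u v + quasiDist N c v w) := by
  unfold quasiDist
  have key : ∀ i, N i (u - w) ^ 2 * (N i w ^ 2 + N i (u - w) ^ 2) ≤
      10 * (N i (u - v) ^ 2 * (N i v ^ 2 + N i (u - v) ^ 2)) +
      10 * (N i (v - w) ^ 2 * (N i w ^ 2 + N i (v - w) ^ 2)) := by
    intro i
    have h1 : N i (u - w) ≤ N i (u - v) + N i (v - w) := by
      simpa using map_add_le_add (N i) (u - v) (v - w)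
    have h2 : N i w ≤ N i (v - w) + N i v := by
      rw [map_sub_rev]; simpa using map_add_le_add (N i) (w - v) v
    have a0 := apply_nonneg (N i) (u - v)
    have b0 := apply_nonneg (N i) (v - w)
    have p0 := apply_nonneg (N i) (u - w)
    have c0 := apply_nonneg (N i) w
    have d0 := apply_nonneg (N i) v
    generalize N i (u - v) = a at *
    generalize N i (v - w) = b at *
    generalize N i (u - w) = p at *
    generalize N i w = q at *
    generalize N i v = d at *
    have hp : p ^ 2 ≤ 2 * a ^ 2 + 2 * b ^ 2 := by
      nlinarith [sq_nonneg (a - b)]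
    have hq : q ^ 2 ≤ 2 * b ^ 2 + 2 * d ^ 2 := by
      nlinarith [sq_nonneg (b - d)]
    have hp4 : p ^ 2 * p ^ 2 ≤ (2 * a ^ 2 + 2 * b ^ 2) * (2 * a ^ 2 + 2 * b ^ 2) := by gcongr
    have e1 : p ^ 2 * q ^ 2 ≤ (2 * a ^ 2 + 2 * b ^ 2) * q ^ 2 := by gcongr
    have e2 : a ^ 2 * q ^ 2 ≤ a ^ 2 * (2 * b ^ 2 + 2 * d ^ 2) := by gcongr
    nlinarith [sq_nonneg (a ^ 2 - b ^ 2), mul_nonneg (sq_nonneg a) (sq_nonneg d),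
      mul_nonneg (sq_nonneg b) (sq_nonneg q)]
  have hs := Finset.sum_le_sum fun i (_ : i ∈ Finset.univ) => key i
  rw [Finset.sum_add_distrib, ← Finset.mul_sum, ← Finset.mul_sum] at hs
  have hn : ‖u - w‖ ^ 2 ≤ 2 * ‖u - v‖ ^ 2 + 2 * ‖v - w‖ ^ 2 := by
    have := norm_sub_le_norm_sub_add_norm_sub u v w
    nlinarith [sq_nonneg (‖u - v‖ - ‖v - w‖), norm_nonneg (u - w)]
  have := mul_le_mul_of_nonneg_left hn hc
  nlinarith [mul_nonneg hc (sq_nonneg ‖u - v‖), mul_nonneg hc (sq_nonneg ‖v - w‖)]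

lemma sum_sq_sub_sq_le_quasiDist {c : ℝ} (hc : 0 ≤ c) (u v : V) :
    ∑ i, (N i u ^ 2 - N i v ^ 2) ^ 2 ≤ 8 * quasiDist N c u v := by
  unfold quasiDist
  rw [mul_add, Finset.mul_sum]
  have h0 : 0 ≤ 8 * (c * ‖u - v‖ ^ 2) := by positivity
  refine le_add_of_le_of_nonneg (Finset.sum_le_sum fun i _ => ?_) h0
  have h1 : |N i u - N i v| ≤ N i (u - v) := abs_sub_map_le_sub (N i) u v
  have h2 : N i u + N i v ≤ 2 * N i v + N i (u - v) := by
    linarith [le_abs_self (N i u - N i v)]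
  have p0 := apply_nonneg (N i) (u - v)
  have c0 := apply_nonneg (N i) u
  have d0 := apply_nonneg (N i) v
  have h3 : (N i u - N i v) ^ 2 ≤ N i (u - v) ^ 2 := sq_le_sq' (by linarith [(abs_le.1 h1).1])
    (abs_le.1 h1).2
  have h4 : (N i u + N i v) ^ 2 ≤ (2 * N i v + N i (u - v)) ^ 2 := by gcongr
  have h5 : (2 * N i v + N i (u - v)) ^ 2 ≤ 8 * (N i v ^ 2 + N i (u - v) ^ 2) := by
    nlinarith [sq_nonneg (2 * N i v - N i (u - v)), sq_nonneg (N i (u - v))]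
  calc (N i u ^ 2 - N i v ^ 2) ^ 2 = (N i u - N i v) ^ 2 * (N i u + N i v) ^ 2 := by ring
    _ ≤ N i (u - v) ^ 2 * (8 * (N i v ^ 2 + N i (u - v) ^ 2)) := by
      gcongr; exact h4.trans h5
    _ = _ := by ring

lemma quasiDist_midpoint_le {c τ : ℝ} (hc : 0 ≤ c) {u u' v : V} (hu : quasiDist N c u v ≤ τ)
    (hu' : quasiDist N c u' v ≤ τ) : quasiDist N c ((1 / 2 : ℝ) • (u + u')) v ≤ τ := by
  have e : (1 / 2 : ℝ) • (u + u') - v = (1 / 2 : ℝ) • ((u - v) + (u' - v)) := by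
    rw [show (u - v) + (u' - v) = (u + u') - (2 : ℝ) • v by rw [two_smul]; abel, smul_sub,
      smul_smul]
    norm_num
  suffices h : 2 * quasiDist N c ((1 / 2 : ℝ) • (u + u')) v ≤
      quasiDist N c u v + quasiDist N c u' v by linarith
  unfold quasiDist
  rw [e]
  have key : ∀ i, 2 * (N i ((1 / 2 : ℝ) • ((u - v) + (u' - v))) ^ 2 *
      (N i v ^ 2 + N i ((1 / 2 : ℝ) • ((u - v) + (u' - v))) ^ 2)) ≤
      N i (u - v) ^ 2 * (N i v ^ 2 + N i (u - v) ^ 2) +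
      N i (u' - v) ^ 2 * (N i v ^ 2 + N i (u' - v) ^ 2) := by
    intro i
    have h1 : N i ((1 / 2 : ℝ) • ((u - v) + (u' - v))) ≤ (N i (u - v) + N i (u' - v)) / 2 := by
      rw [map_smul_eq_mul]
      have := map_add_le_add (N i) (u - v) (u' - v)
      norm_num
      linarith
    have p0 := apply_nonneg (N i) ((1 / 2 : ℝ) • ((u - v) + (u' - v)))
    generalize N i ((1 / 2 : ℝ) • ((u - v) + (u' - v))) = p at *
    generalize N i (u - v) = a at *
    generalize N i (u' - v) = b at *
    generalize N i v = q at *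
    have hp : p ^ 2 ≤ (a ^ 2 + b ^ 2) / 2 := by nlinarith [sq_nonneg (a - b)]
    have hp4 : p ^ 2 * p ^ 2 ≤ (a ^ 2 + b ^ 2) / 2 * ((a ^ 2 + b ^ 2) / 2) := by gcongr
    have e1 : p ^ 2 * q ^ 2 ≤ (a ^ 2 + b ^ 2) / 2 * q ^ 2 := by gcongr
    nlinarith [sq_nonneg (a ^ 2 - b ^ 2)]
  have hs := Finset.sum_le_sum fun i (_ : i ∈ Finset.univ) => key i
  rw [Finset.sum_add_distrib, ← Finset.mul_sum] at hs
  have hn : 2 * ‖(1 / 2 : ℝ) • ((u - v) + (u' - v))‖ ^ 2 ≤ ‖u - v‖ ^ 2 + ‖u' - v‖ ^ 2 := by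
    rw [norm_smul]
    have := norm_add_le (u - v) (u' - v)
    have h2 : ‖(u - v) + (u' - v)‖ ^ 2 ≤ (‖u - v‖ + ‖u' - v‖) ^ 2 := by gcongr
    norm_num
    nlinarith [sq_nonneg (‖u - v‖ - ‖u' - v‖)]
  have := mul_le_mul_of_nonneg_left hn hc
  nlinarith

/-- Strong convexity gain of `normEnergy` at a minimiser over a midpoint-convex set. -/
lemma sq_norm_add_sum_sq_le_of_midpoint {w h : V}
    (hmin : normEnergy N w ≤ normEnergy N ((1 / 2 : ℝ) • ((w + h) + w))) :
    ‖h‖ ^ 2 + ∑ i, (N i (w + h) - N i w) ^ 2 ≤ 2 * (normEnergy N (w + h) - normEnergy N w) := by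
  unfold normEnergy energy at *
  have key : ∀ i, 4 * N i ((1 / 2 : ℝ) • ((w + h) + w)) ^ 2 + (N i (w + h) - N i w) ^ 2 ≤
      2 * N i (w + h) ^ 2 + 2 * N i w ^ 2 := by
    intro i
    have h1 : N i ((1 / 2 : ℝ) • ((w + h) + w)) ≤ (N i (w + h) + N i w) / 2 := by
      rw [map_smul_eq_mul]
      have := map_add_le_add (N i) (w + h) w
      norm_num
      linarith
    have p0 := apply_nonneg (N i) ((1 / 2 : ℝ) • ((w + h) + w))
    nlinarith
  have hs := Finset.sum_le_sum fun i (_ : i ∈ Finset.univ) => key i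
  rw [Finset.sum_add_distrib, Finset.sum_add_distrib, ← Finset.mul_sum, ← Finset.mul_sum,
    ← Finset.mul_sum] at hs
  have hn : 4 * ‖(1 / 2 : ℝ) • ((w + h) + w)‖ ^ 2 + ‖h‖ ^ 2 = 2 * ‖w + h‖ ^ 2 + 2 * ‖w‖ ^ 2 := by
    have := parallelogram_law_with_norm ℝ (w + h) w
    rw [show w + h - w = h by abel] at this
    rw [norm_smul]
    norm_num
    nlinarith
  linarith

lemma sum_active_sq_le {w h : V} [DecidablePred fun i => 16 * N i w ≤ N i h] :
    ∑ i with 16 * N i w ≤ N i h, N i h ^ 2 ≤ 2 * ∑ i, (N i (w + h) - N i w) ^ 2 := by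
  rw [Finset.mul_sum]
  refine (Finset.sum_le_sum fun i hi => ?_).trans
    (Finset.sum_le_sum_of_subset_of_nonneg (Finset.subset_univ _) fun i _ _ => by positivity)
  rw [Finset.mem_filter] at hi
  have h1 : N i h ≤ N i (w + h) + N i w := by
    have := map_add_le_add (N i) (w + h) (-w)
    rwa [map_neg_eq_map, show w + h + -w = h by abel] at this
  have h2 : 7 / 8 * N i h ≤ N i (w + h) - N i w := by linarith [hi.2]
  have h3 := apply_nonneg (N i) h
  nlinarith

/-- Comparison of `quasiDist` near a minimiser with a quadratic gauge. -/
lemma quasiDist_add_add_le {Ninf : Seminorm ℝ V} (hle : ∀ i v, N i v ≤ Ninf v) {c β : ℝ}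
    {w h h' : V} (hh : ∑ i, (N i (w + h) - N i w) ^ 2 ≤ 2 * β)
    (hh' : ∑ i, (N i (w + h') - N i w) ^ 2 ≤ 2 * β) :
    quasiDist N c (w + h) (w + h') ≤
      1540 * ∑ i, N i w ^ 2 * N i (h - h') ^ 2 + 24 * β * Ninf (h - h') ^ 2 +
        c * ‖h - h'‖ ^ 2 := by
  classical
  unfold quasiDist
  rw [show w + h - (w + h') = h - h' by abel]
  have hact : ∀ z : V, (∑ i, (N i (w + z) - N i w) ^ 2 ≤ 2 * β) →
      ∑ i, (if 16 * N i w ≤ N i z then N i z ^ 2 else 0) ≤ 4 * β := by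
    intro z hz
    rw [← Finset.sum_filter]
    linarith [sum_active_sq_le N (w := w) (h := z)]
  have key : ∀ i, N i (h - h') ^ 2 * (N i (w + h') ^ 2 + N i (h - h') ^ 2) ≤
      1540 * (N i w ^ 2 * N i (h - h') ^ 2) +
      Ninf (h - h') ^ 2 * (4 * (if 16 * N i w ≤ N i h' then N i h' ^ 2 else 0) +
        2 * (if 16 * N i w ≤ N i h then N i h ^ 2 else 0)) := by
    intro i
    have a1 := map_add_le_add (N i) w h'
    have a2 := map_sub_le_add (N i) h h'
    have a3 := hle i (h - h')
    have z0 := apply_nonneg (N i) (h - h')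
    have z1 := apply_nonneg (N i) (w + h')
    have z2 := apply_nonneg (N i) w
    have z3 := apply_nonneg (N i) h
    have z4 := apply_nonneg (N i) h'
    have b : ∀ z, 0 ≤ N i z → N i z ^ 2 ≤
        256 * N i w ^ 2 + (if 16 * N i w ≤ N i z then N i z ^ 2 else 0) := by
      intro z hz
      split_ifs with hif
      · nlinarith [sq_nonneg (N i w)]
      · push Not at hif; nlinarith
    have b1 := b h z3
    have b2 := b h' z4
    have d1 : 0 ≤ (if 16 * N i w ≤ N i h then N i h ^ 2 else 0) := by split_ifs <;> positivity
    have d2 : 0 ≤ (if 16 * N i w ≤ N i h' then N i h' ^ 2 else 0) := by split_ifs <;> positivity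
    generalize (if 16 * N i w ≤ N i h then N i h ^ 2 else 0) = A at *
    generalize (if 16 * N i w ≤ N i h' then N i h' ^ 2 else 0) = A' at *
    have f1 : N i (w + h') ^ 2 ≤ 2 * N i w ^ 2 + 2 * N i h' ^ 2 := by
      nlinarith [sq_nonneg (N i w - N i h')]
    have f2 : N i (h - h') ^ 2 ≤ 2 * N i h ^ 2 + 2 * N i h' ^ 2 := by
      nlinarith [sq_nonneg (N i h - N i h')]
    have f3 : N i (w + h') ^ 2 + N i (h - h') ^ 2 ≤ 1540 * N i w ^ 2 + (4 * A' + 2 * A) := by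
      nlinarith [sq_nonneg (N i w)]
    have f4 : N i (h - h') ^ 2 * (4 * A' + 2 * A) ≤ Ninf (h - h') ^ 2 * (4 * A' + 2 * A) := by
      gcongr
    nlinarith [mul_le_mul_of_nonneg_left f3 (sq_nonneg (N i (h - h')))]
  have hs := Finset.sum_le_sum fun i (_ : i ∈ Finset.univ) => key i
  rw [Finset.sum_add_distrib, ← Finset.mul_sum, ← Finset.mul_sum, Finset.sum_add_distrib,
    ← Finset.mul_sum, ← Finset.mul_sum] at hs
  nlinarith [mul_le_mul_of_nonneg_left (hact h hh) (sq_nonneg (Ninf (h - h'))),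
    mul_le_mul_of_nonneg_left (hact h' hh') (sq_nonneg (Ninf (h - h')))]

end SquareFunctionGeometry

section BalancedFamily

open MeasureTheory

variable {V : Type*} [NormedAddCommGroup V] [InnerProductSpace ℝ V] [FiniteDimensional ℝ V]
  [MeasurableSpace V] [BorelSpace V] {ι : Type*} [Fintype ι]

/-- A family of seminorms with small operator norms and small Gaussian second moments, whose
square sum is controlled by the dimension bound `n`. -/
structure IsBalanced (N : ι → Seminorm ℝ V) (Ninf : Seminorm ℝ V) (δ n a b : ℝ) : Prop where
  pos : 0 < δ
  one_le_dim : 1 ≤ n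
  finrank_le : (Module.finrank ℝ V : ℝ) ≤ n
  one_le_left : 1 ≤ a
  one_le_right : 1 ≤ b
  le_sup : ∀ i v, N i v ≤ Ninf v
  sup_sq_le : ∀ v, Ninf v ^ 2 ≤ δ * ‖v‖ ^ 2
  gaussMean : ∀ i, GaussMeanLE (fun v => N i v ^ 2) (δ * a)
  gaussMean_sup : GaussMeanLE (fun v => Ninf v ^ 2) (δ * b)
  energy_le : ∀ v, energy N v ≤ 2 * n * ‖v‖ ^ 2

lemma Seminorm.continuous_of_sq_le {E : Type*} [NormedAddCommGroup E] [NormedSpace ℝ E]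
    {p : Seminorm ℝ E} {δ : ℝ} (hp : ∀ v, p v ^ 2 ≤ δ * ‖v‖ ^ 2) : Continuous p := by
  refine Seminorm.continuous_of_le (q := Real.toNNReal (Real.sqrt δ) • normSeminorm ℝ E) ?_ ?_
  · have : (⇑(Real.toNNReal (Real.sqrt δ) • normSeminorm ℝ E) : E → ℝ) =
        fun v => Real.sqrt δ * ‖v‖ := by
      ext v
      simp [NNReal.smul_def]
    rw [this]
    fun_prop
  · intro v
    have h1 : p v ≤ Real.sqrt δ * ‖v‖ := by
      have h2 := Real.abs_le_sqrt (hp v)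
      rw [Real.sqrt_mul' _ (sq_nonneg _), Real.sqrt_sq (norm_nonneg v)] at h2
      exact (le_abs_self _).trans h2
    simpa [NNReal.smul_def] using h1

namespace IsBalanced

variable {N : ι → Seminorm ℝ V} {Ninf : Seminorm ℝ V} {δ n a b : ℝ}

lemma sq_le (hN : IsBalanced N Ninf δ n a b) (i : ι) (v : V) : N i v ^ 2 ≤ δ * ‖v‖ ^ 2 :=
  (pow_le_pow_left₀ (apply_nonneg _ _) (hN.le_sup i v) 2).trans (hN.sup_sq_le v)

lemma continuous (hN : IsBalanced N Ninf δ n a b) (i : ι) : Continuous (N i) :=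
  Seminorm.continuous_of_sq_le (hN.sq_le i)

lemma continuous_sup (hN : IsBalanced N Ninf δ n a b) : Continuous Ninf :=
  Seminorm.continuous_of_sq_le hN.sup_sq_le

lemma div_pos (hN : IsBalanced N Ninf δ n a b) : 0 < δ / n :=
  _root_.div_pos hN.pos (one_pos.trans_le hN.one_le_dim)

lemma exists_min (hN : IsBalanced N Ninf δ n a b) (τ : ℝ) (hτ : 0 ≤ τ) (v : V) :
    ∃ u, quasiDist N (δ / n) u v ≤ τ ∧
      ∀ u', quasiDist N (δ / n) u' v ≤ τ → normEnergy N u ≤ normEnergy N u' := by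
  have hc : ∀ i, Continuous (N i) := hN.continuous
  have hcont : Continuous fun u => quasiDist N (δ / n) u v := by
    unfold quasiDist
    fun_prop
  have hcont2 : Continuous (normEnergy N) := by
    unfold normEnergy energy
    fun_prop
  have hclosed : IsClosed {u | quasiDist N (δ / n) u v ≤ τ} :=
    isClosed_le hcont continuous_const
  have hbdd : {u | quasiDist N (δ / n) u v ≤ τ} ⊆
      Metric.closedBall v (Real.sqrt (τ / (δ / n))) := by
    intro u hu
    rw [Metric.mem_closedBall, dist_eq_norm]
    apply Real.le_sqrt_of_sq_le
    rw [le_div_iff₀ hN.div_pos, mul_comm]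
    exact (mul_norm_sq_le_quasiDist N u v).trans hu
  have hcomp : IsCompact {u | quasiDist N (δ / n) u v ≤ τ} :=
    (isCompact_closedBall v _).of_isClosed_subset hclosed hbdd
  obtain ⟨u, hu, hmin⟩ := hcomp.exists_isMinOn
    ⟨v, by simpa [quasiDist_self] using hτ⟩ hcont2.continuousOn
  exact ⟨u, hu, fun u' hu' => hmin hu'⟩

lemma quasiDist_le_of_normEnergy_le (hN : IsBalanced N Ninf δ n a b) {u v : V}
    (hu : normEnergy N u ≤ 3)
    (hv : normEnergy N v ≤ 3) : quasiDist N (δ / n) u v ≤ 200 * δ := by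
  have hu' := hu
  have hv' := hv
  unfold normEnergy at hu' hv'
  have eu := energy_nonneg N u
  have ev := energy_nonneg N v
  have hnorm : ‖u - v‖ ^ 2 ≤ 12 := by
    have := norm_sub_le u v
    nlinarith [sq_nonneg (‖u‖ - ‖v‖), norm_nonneg (u - v)]
  have hE : energy N (u - v) ≤ 12 := by
    have : energy N (u - v) ≤ 2 * energy N u + 2 * energy N v := by
      unfold energy
      rw [Finset.mul_sum, Finset.mul_sum, ← Finset.sum_add_distrib]
      refine Finset.sum_le_sum fun i _ => ?_
      have := map_sub_le_add (N i) u v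
      nlinarith [sq_nonneg (N i u - N i v), apply_nonneg (N i) (u - v)]
    nlinarith [sq_nonneg ‖u‖, sq_nonneg ‖v‖]
  have h1 : ∑ i, N i (u - v) ^ 2 * (N i v ^ 2 + N i (u - v) ^ 2) ≤
      ∑ i, 12 * δ * (N i v ^ 2 + N i (u - v) ^ 2) := by
    refine Finset.sum_le_sum fun i _ => ?_
    gcongr
    refine (hN.sq_le i _).trans ?_
    rw [mul_comm]
    exact mul_le_mul_of_nonneg_right hnorm hN.pos.le
  rw [← Finset.mul_sum, Finset.sum_add_distrib] at h1
  have h2 : δ / n * ‖u - v‖ ^ 2 ≤ δ * 12 := by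
    have : δ / n ≤ δ := div_le_self hN.pos.le hN.one_le_dim
    have := hN.pos
    gcongr
  unfold quasiDist
  unfold energy at *
  have := hN.pos
  have h3 : ∑ i, N i v ^ 2 ≤ 3 := by nlinarith [sq_nonneg ‖v‖]
  nlinarith

/-- The minimal `normEnergy` over the quasi-ball of radius `τ` around `v` is at most
`normEnergy N v` and decays slowly with `τ`. -/
lemma normEnergy_sub_le (hN : IsBalanced N Ninf δ n a b) {τ : ℝ} {u v : V}
    (hv : normEnergy N v ≤ 3) (hu : normEnergy N u ≤ 3)
    (huv : quasiDist N (δ / n) u v ≤ τ) :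
    normEnergy N v - normEnergy N u ≤ 10 * n * Real.sqrt (τ / δ) := by
  have hn := hN.one_le_dim
  have hd := hN.pos
  have hu' := hu
  have hv' := hv
  unfold normEnergy at hu' hv'
  have eu := energy_nonneg N u
  have ev := energy_nonneg N v
  have hdist : ‖u - v‖ ≤ Real.sqrt n * Real.sqrt (τ / δ) := by
    rw [← Real.sqrt_mul (by linarith)]
    apply Real.le_sqrt_of_sq_le
    have h1 := (mul_norm_sq_le_quasiDist N u v).trans huv
    rw [div_mul_eq_mul_div, div_le_iff₀ (by linarith)] at h1
    rw [mul_div_assoc', le_div_iff₀ hd]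
    linarith
  have hnn : ‖v‖ ^ 2 - ‖u‖ ^ 2 ≤ 4 * ‖u - v‖ := by
    have h1 : ‖v‖ - ‖u‖ ≤ ‖u - v‖ := by
      rw [norm_sub_rev]; exact (norm_sub_norm_le v u)
    have h2 : ‖v‖ + ‖u‖ ≤ 4 := by nlinarith [norm_nonneg u, norm_nonneg v, sq_nonneg (‖u‖ - ‖v‖)]
    nlinarith [norm_nonneg u, norm_nonneg v, norm_nonneg (u - v)]
  have hEE : energy N v - energy N u ≤ 6 * Real.sqrt n * ‖u - v‖ := by
    have h1 : energy N v - energy N u ≤ ∑ i, N i (u - v) * (N i v + N i u) := by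
      unfold energy
      rw [← Finset.sum_sub_distrib]
      refine Finset.sum_le_sum fun i _ => ?_
      have h2 : N i v - N i u ≤ N i (u - v) := by
        rw [map_sub_rev]
        exact (le_abs_self _).trans (abs_sub_map_le_sub (N i) v u)
      nlinarith [apply_nonneg (N i) u, apply_nonneg (N i) v]
    have h2 := Finset.sum_mul_sq_le_sq_mul_sq Finset.univ (fun i => N i (u - v))
      (fun i => N i v + N i u)
    have h3 : ∑ i, (N i v + N i u) ^ 2 ≤ 12 := by
      have : ∑ i, (N i v + N i u) ^ 2 ≤ 2 * energy N v + 2 * energy N u := by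
        unfold energy
        rw [Finset.mul_sum, Finset.mul_sum, ← Finset.sum_add_distrib]
        refine Finset.sum_le_sum fun i _ => ?_
        nlinarith [sq_nonneg (N i u - N i v)]
      nlinarith [sq_nonneg ‖u‖, sq_nonneg ‖v‖]
    have h4 : ∑ i, N i (u - v) ^ 2 ≤ 2 * n * ‖u - v‖ ^ 2 := hN.energy_le (u - v)
    have h5 : (∑ i, N i (u - v) * (N i v + N i u)) ^ 2 ≤ (6 * Real.sqrt n * ‖u - v‖) ^ 2 := by
      refine h2.trans ?_
      have h6 : (6 * Real.sqrt n * ‖u - v‖) ^ 2 = 36 * n * ‖u - v‖ ^ 2 := by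
        rw [mul_pow, mul_pow, Real.sq_sqrt (by linarith)]; norm_num
      rw [h6]
      have h7 : 0 ≤ n * ‖u - v‖ ^ 2 := by positivity
      calc _ ≤ (2 * n * ‖u - v‖ ^ 2) * 12 := by gcongr
        _ ≤ _ := by nlinarith
    exact h1.trans (abs_le_of_sq_le_sq' h5 (by positivity)).2
  have hsn : 1 ≤ Real.sqrt n := Real.one_le_sqrt.2 hn
  have hss : Real.sqrt n * Real.sqrt n = n := Real.mul_self_sqrt (by linarith)
  have h8 : normEnergy N v - normEnergy N u ≤ 10 * Real.sqrt n * ‖u - v‖ := by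
    unfold normEnergy
    nlinarith [norm_nonneg (u - v)]
  calc _ ≤ 10 * Real.sqrt n * ‖u - v‖ := h8
    _ ≤ 10 * Real.sqrt n * (Real.sqrt n * Real.sqrt (τ / δ)) := by gcongr
    _ = 10 * (Real.sqrt n * Real.sqrt n) * Real.sqrt (τ / δ) := by ring
    _ = _ := by rw [hss]

/-- A cell of quasi-radius `ρ` splits into cells of quasi-radius `ρ / 256`; the number of pieces
among points whose minimal energy drops by at most `β` between radii `256 ^ 2 * ρ` and
`ρ / 256 ^ 2` is controlled by `β`. -/
lemma exists_label (hN : IsBalanced N Ninf δ n a b) (m : ℝ → V → V)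
    (hm : ∀ τ v, 0 ≤ τ → quasiDist N (δ / n) (m τ v) v ≤ τ ∧
      ∀ u', quasiDist N (δ / n) u' v ≤ τ → normEnergy N (m τ v) ≤ normEnergy N u')
    {ρ β : ℝ} (hρ : 0 < ρ) (hβ : 0 < β) (z : V) (hz : normEnergy N z ≤ 3) :
    ∃ ℓ : V → ℕ,
      (∀ v, quasiDist N (δ / n) v z ≤ 256 ^ 2 * ρ →
        normEnergy N (m ρ v) - normEnergy N (m (256 ^ 4 * ρ) v) ≤ β →
        (ℓ v : ℝ) + 1 ≤ 2 * Real.exp (160000 * δ / ρ * β * (a + β * b))) ∧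
      ∀ v v', quasiDist N (δ / n) v z ≤ 256 ^ 2 * ρ → quasiDist N (δ / n) v' z ≤ 256 ^ 2 * ρ →
        normEnergy N (m ρ v) - normEnergy N (m (256 ^ 4 * ρ) v) ≤ β →
        normEnergy N (m ρ v') - normEnergy N (m (256 ^ 4 * ρ) v') ≤ β →
        ℓ v = ℓ v' → quasiDist N (δ / n) v v' ≤ 256 * ρ := by
  have hc0 := hN.div_pos
  have hd := hN.pos
  have hn := hN.one_le_dim
  have ha := hN.one_le_left
  have hb := hN.one_le_right
  have hcN : ∀ i, Continuous (N i) := hN.continuous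
  have hcS : Continuous Ninf := hN.continuous_sup
  set w := m (256 ^ 3 * ρ) z with hw
  obtain ⟨hw1, hw2⟩ := hm (256 ^ 3 * ρ) z (by positivity)
  rw [← hw] at hw1 hw2
  have hw3 : normEnergy N w ≤ 3 := (hw2 z (by rw [quasiDist_self]; positivity)).trans hz
  have hmem : ∀ v, quasiDist N (δ / n) v z ≤ 256 ^ 2 * ρ →
      quasiDist N (δ / n) (m ρ v) z ≤ 256 ^ 3 * ρ := by
    intro v hv
    have h1 := quasiDist_triangle N hc0.le (m ρ v) v z
    have h2 := (hm ρ v hρ.le).1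
    nlinarith
  have hgap : ∀ v, quasiDist N (δ / n) v z ≤ 256 ^ 2 * ρ →
      normEnergy N (m ρ v) - normEnergy N (m (256 ^ 4 * ρ) v) ≤ β →
      normEnergy N (m ρ v) - normEnergy N w ≤ β := by
    intro v hv hle
    have h1 := quasiDist_triangle N hc0.le w z v
    have h2 := quasiDist_symm_le N hc0.le v z
    have h3 := (hm (256 ^ 4 * ρ) v (by positivity)).2 w (by linarith)
    linarith
  have hconv : ∀ v, quasiDist N (δ / n) v z ≤ 256 ^ 2 * ρ →
      normEnergy N (m ρ v) - normEnergy N (m (256 ^ 4 * ρ) v) ≤ β →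
      ‖m ρ v - w‖ ^ 2 + ∑ i, (N i (w + (m ρ v - w)) - N i w) ^ 2 ≤ 2 * β := by
    intro v hv hle
    have h1 := sq_norm_add_sum_sq_le_of_midpoint N (w := w) (h := m ρ v - w) (by
      rw [show w + (m ρ v - w) = m ρ v by abel]
      exact hw2 _ (quasiDist_midpoint_le N hc0.le (hmem v hv) hw1))
    have h2 := hgap v hv hle
    rw [show w + (m ρ v - w) = m ρ v by abel] at h1 ⊢
    linarith
  let Q : V → ℝ := fun g =>
    1540 * ∑ i, N i w ^ 2 * N i g ^ 2 + 24 * β * Ninf g ^ 2 + δ / n * ‖g‖ ^ 2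
  have hQm : Continuous Q := by fun_prop
  have hsub : ∀ (p : Seminorm ℝ V) x y, p (x + y) ^ 2 ≤ 2 * p x ^ 2 + 2 * p y ^ 2 := by
    intro p x y
    have := map_add_le_add p x y
    nlinarith [sq_nonneg (p x - p y), apply_nonneg p (x + y)]
  set M := 5000 * δ * (a + β * b) with hM
  have hMpos : 0 < M := by positivity
  have hQM : GaussMeanLE Q M := by
    have h1 : GaussMeanLE (fun g => ∑ i, N i w ^ 2 * N i g ^ 2)
        (∑ i, N i w ^ 2 * (δ * a)) :=
      GaussMeanLE.sum _ (fun i _ => (hN.gaussMean i).const_mul (sq_nonneg _))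
        (fun i _ => by positivity) (fun i _ => Continuous.measurable (by fun_prop))
    have h2 := ((h1.const_mul (c := 1540) (by norm_num)).add
      (hN.gaussMean_sup.const_mul (c := 24 * β) (by positivity)) ?_ (by positivity)
      (Continuous.measurable (by fun_prop))).add
      ((gaussMeanLE_norm_sq (V := V)).const_mul (c := δ / n) hc0.le) ?_ (by positivity)
      (Continuous.measurable (by fun_prop))
    · refine h2.mono (fun x => le_rfl) ?_
      have h3 : ∑ i, N i w ^ 2 * (δ * a) ≤ 3 * (δ * a) := by
        rw [← Finset.sum_mul]
        have : energy N w ≤ 3 := by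
          unfold normEnergy at hw3
          nlinarith [sq_nonneg ‖w‖]
        exact mul_le_mul_of_nonneg_right this (by positivity)
      have h4 : δ / n * (16 * (Module.finrank ℝ V : ℝ)) ≤ 16 * δ := by
        rw [div_mul_eq_mul_div, div_le_iff₀ (by linarith)]
        nlinarith [hN.finrank_le]
      rw [hM]
      nlinarith [mul_pos hd (mul_pos hβ (one_pos.trans_le hb))]
    · exact mul_nonneg (by norm_num) (Finset.sum_nonneg fun i _ => by positivity)
    · refine add_nonneg ?_ (by positivity)
      exact mul_nonneg (by norm_num) (Finset.sum_nonneg fun i _ => by positivity)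
  set s := Real.sqrt (ρ / (32 * M)) with hs
  have hs2 : s ^ 2 = ρ / (32 * M) := Real.sq_sqrt (by positivity)
  obtain ⟨ℓ, hℓ1, hℓ2⟩ := exists_gaussian_label (Q := Q) hQm.measurable
    (fun x => by simp only [Q, map_neg_eq_map, norm_neg])
    (fun x y => by
      simp only [Q]
      have h1 : ∑ i, N i w ^ 2 * N i (x + y) ^ 2 ≤
          2 * ∑ i, N i w ^ 2 * N i x ^ 2 + 2 * ∑ i, N i w ^ 2 * N i y ^ 2 := by
        rw [Finset.mul_sum, Finset.mul_sum, ← Finset.sum_add_distrib]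
        refine Finset.sum_le_sum fun i _ => ?_
        nlinarith [mul_le_mul_of_nonneg_left (hsub (N i) x y) (sq_nonneg (N i w))]
      have h2 := mul_le_mul_of_nonneg_left (hsub Ninf x y) (show 0 ≤ 24 * β by positivity)
      have h3 := mul_le_mul_of_nonneg_left (hsub (normSeminorm ℝ V) x y) hc0.le
      simp only [coe_normSeminorm] at h3
      linarith)
    (fun c x => by
      simp only [Q, map_smul_eq_mul, norm_smul, mul_pow, Real.norm_eq_abs, sq_abs]
      rw [mul_add, mul_add]
      congr 1
      · congr 1
        · rw [mul_left_comm, Finset.mul_sum (a := c ^ 2)]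
          congr 1
          exact Finset.sum_congr rfl fun i _ => by ring
        · ring
      · ring)
    hMpos hQM (b := 2 * β) (s := s) (Real.sqrt_pos.2 (by positivity))
  refine ⟨fun v => ℓ (m ρ v - w), fun v hv hle => ?_, fun v v' hv hv' hle hle' he => ?_⟩
  · have h1 := hconv v hv hle
    have h2 : 0 ≤ ∑ i, (N i (w + (m ρ v - w)) - N i w) ^ 2 :=
      Finset.sum_nonneg fun _ _ => sq_nonneg _
    have h3 := hℓ1 (m ρ v - w) (by linarith)
    refine h3.trans_eq ?_
    congr 2
    rw [hs2, hM]
    field_simp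
    norm_num
  · have h1 := hconv v hv hle
    have h1' := hconv v' hv' hle'
    have h2 : 0 ≤ ∑ i, (N i (w + (m ρ v - w)) - N i w) ^ 2 :=
      Finset.sum_nonneg fun _ _ => sq_nonneg _
    have h2' : 0 ≤ ∑ i, (N i (w + (m ρ v' - w)) - N i w) ^ 2 :=
      Finset.sum_nonneg fun _ _ => sq_nonneg _
    have h3 := hℓ2 _ _ (by linarith) (by linarith) he
    have h4 := quasiDist_add_add_le N hN.le_sup (c := δ / n) (β := β) (w := w)
      (h := m ρ v - w) (h' := m ρ v' - w) (by linarith [sq_nonneg ‖m ρ v - w‖])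
      (by linarith [sq_nonneg ‖m ρ v' - w‖])
    have h5 : 32 * s ^ 2 * M = ρ := by rw [hs2]; field_simp
    rw [h5] at h3
    have h6 := h4.trans h3
    rw [show w + (m ρ v - w) = m ρ v by abel, show w + (m ρ v' - w) = m ρ v' by abel] at h6
    have t1 := quasiDist_triangle N hc0.le v (m ρ v) v'
    have t2 := quasiDist_triangle N hc0.le (m ρ v) (m ρ v') v'
    have t3 := quasiDist_symm_le N hc0.le (m ρ v) v
    have t4 := (hm ρ v hρ.le).1
    have t5 := (hm ρ v' hρ.le).1
    linarith

end IsBalanced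

end BalancedFamily

section RandomSigns

variable {ι : Type*} [Fintype ι]

/-- The sign `±1` attached to a boolean. -/
def boolSign (b : Bool) : ℝ := if b then 1 else -1

/-- The signed sum of the entries of `y`. -/
noncomputable def signSum (σ : ι → Bool) (y : ι → ℝ) : ℝ := ∑ i, boolSign (σ i) * y i

lemma boolSign_sq (b : Bool) : boolSign b ^ 2 = 1 := by cases b <;> simp [boolSign]

lemma signSum_sub (σ : ι → Bool) (y z : ι → ℝ) :
    signSum σ y - signSum σ z = signSum σ fun i => y i - z i := by
  simp only [signSum, mul_sub, Finset.sum_sub_distrib]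

lemma abs_signSum_le (σ : ι → Bool) (y : ι → ℝ) :
    |signSum σ y| ≤ Real.sqrt (Fintype.card ι * ∑ i, y i ^ 2) := by
  apply Real.abs_le_sqrt
  have h := Finset.sum_mul_sq_le_sq_mul_sq Finset.univ (fun i => boolSign (σ i)) y
  simpa [signSum, boolSign_sq] using h

lemma sum_exp_signSum_le [DecidableEq ι] (y : ι → ℝ) :
    ∑ σ : ι → Bool, Real.exp (signSum σ y) ≤
      2 ^ Fintype.card ι * Real.exp ((∑ i, y i ^ 2) / 2) := by
  have h1 : ∑ σ : ι → Bool, Real.exp (signSum σ y) =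
      ∏ i, ∑ b : Bool, Real.exp (boolSign b * y i) := by
    rw [Finset.prod_univ_sum, Fintype.piFinset_univ]
    exact Finset.sum_congr rfl fun σ _ => by rw [signSum, Real.exp_sum]
  have h2 : ∀ i, ∑ b : Bool, Real.exp (boolSign b * y i) ≤ 2 * Real.exp (y i ^ 2 / 2) := by
    intro i
    have := Real.cosh_le_exp_half_sq (y i)
    rw [Real.cosh_eq] at this
    simp [boolSign]
    linarith
  rw [h1]
  refine (Finset.prod_le_prod (fun i _ => Finset.sum_nonneg fun _ _ => (Real.exp_nonneg _))
    fun i _ => h2 i).trans_eq ?_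
  rw [Finset.prod_mul_distrib, Finset.prod_const, ← Real.exp_sum, Finset.sum_div,
    Finset.card_univ]

lemma card_lt_signSum_le [DecidableEq ι] (y : ι → ℝ) {s t : ℝ} (hs : 0 < s) (ht : 0 ≤ t)
    (hy : ∑ i, y i ^ 2 ≤ s) :
    ((Finset.univ.filter fun σ : ι → Bool => t < signSum σ y).card : ℝ) ≤
      2 ^ Fintype.card ι * Real.exp (-t ^ 2 / (2 * s)) := by
  set l := t / s with hl
  have hl0 : 0 ≤ l := by positivity
  have h1 := sum_exp_signSum_le fun i => l * y i
  have h2 : ∀ σ : ι → Bool, signSum σ (fun i => l * y i) = l * signSum σ y := by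
    intro σ
    simp only [signSum, Finset.mul_sum]
    exact Finset.sum_congr rfl fun i _ => by ring
  have h3 : ((Finset.univ.filter fun σ : ι → Bool => t < signSum σ y).card : ℝ) *
      Real.exp (l * t) ≤ ∑ σ : ι → Bool, Real.exp (signSum σ fun i => l * y i) := by
    rw [← nsmul_eq_mul, ← Finset.sum_const]
    refine (Finset.sum_le_sum fun σ hσ => ?_).trans
      (Finset.sum_le_sum_of_subset_of_nonneg (Finset.subset_univ _) fun _ _ _ =>
        Real.exp_nonneg _)
    rw [h2]
    apply Real.exp_le_exp.2
    exact mul_le_mul_of_nonneg_left (Finset.mem_filter.1 hσ).2.le hl0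
  have h4 : (∑ i, (l * y i) ^ 2) / 2 ≤ l ^ 2 * s / 2 := by
    simp only [mul_pow, ← Finset.mul_sum]
    gcongr
  have h5 : ((Finset.univ.filter fun σ : ι → Bool => t < signSum σ y).card : ℝ) *
      Real.exp (l * t) ≤ 2 ^ Fintype.card ι * Real.exp (l ^ 2 * s / 2) :=
    (h3.trans h1).trans (by gcongr)
  rw [← le_div_iff₀ (Real.exp_pos _), mul_div_assoc, ← Real.exp_sub] at h5
  refine h5.trans_eq ?_
  congr 2
  rw [hl]
  field_simp
  ring

/-- Union bound over a possibly infinite family of sub-Gaussian events. -/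
lemma exists_signs {Z : Type*} (y : Z → ι → ℝ) (s t q : Z → ℝ) (hs : ∀ z, 0 < s z)
    (ht : ∀ z, 0 ≤ t z) (hy : ∀ z, ∑ i, y z i ^ 2 ≤ s z)
    (hq : ∀ z, 2 * Real.exp (-t z ^ 2 / (2 * s z)) ≤ q z)
    (hsum : ∀ S : Finset Z, ∑ z ∈ S, q z < 1) :
    ∃ σ : ι → Bool, ∀ z, |signSum σ (y z)| ≤ t z := by
  classical
  by_contra hcon
  push Not at hcon
  choose f hf using hcon
  let S := Finset.univ.image f
  have hq0 : ∀ z, 0 ≤ q z := fun z => le_trans (by positivity) (hq z)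
  have hbad : ∀ z, ((Finset.univ.filter fun σ : ι → Bool => t z < |signSum σ (y z)|).card : ℝ) ≤
      2 ^ Fintype.card ι * q z := by
    intro z
    have e : (Finset.univ.filter fun σ : ι → Bool => t z < |signSum σ (y z)|) ⊆
        (Finset.univ.filter fun σ : ι → Bool => t z < signSum σ (y z)) ∪
        (Finset.univ.filter fun σ : ι → Bool => t z < signSum σ (fun i => -y z i)) := by
      intro σ hσ
      have hneg : signSum σ (fun i => -y z i) = -signSum σ (y z) := by
        simp [signSum]
      simp only [Finset.mem_filter, Finset.mem_univ, true_and, Finset.mem_union, hneg] at hσ ⊢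
      exact lt_abs.1 hσ
    have h1 := card_lt_signSum_le (y z) (hs z) (ht z) (hy z)
    have h2 := card_lt_signSum_le (fun i => -y z i) (hs z) (ht z) (by simpa using hy z)
    have h3 : ((Finset.univ.filter fun σ : ι → Bool => t z < |signSum σ (y z)|).card : ℝ) ≤
        (Finset.univ.filter fun σ : ι → Bool => t z < signSum σ (y z)).card +
        (Finset.univ.filter fun σ : ι → Bool => t z < signSum σ (fun i => -y z i)).card := by
      exact_mod_cast (Finset.card_le_card e).trans (Finset.card_union_le _ _)
    have h4 := mul_le_mul_of_nonneg_left (hq z) (show (0 : ℝ) ≤ 2 ^ Fintype.card ι by positivity)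
    linarith
  have hcover : (Finset.univ : Finset (ι → Bool)) ⊆
      S.biUnion fun z => Finset.univ.filter fun σ : ι → Bool => t z < |signSum σ (y z)| := by
    intro σ _
    simp only [Finset.mem_biUnion, Finset.mem_filter, Finset.mem_univ, true_and]
    exact ⟨f σ, Finset.mem_image_of_mem _ (Finset.mem_univ _), hf σ⟩
  have h1 : ((2 : ℝ) ^ Fintype.card ι) ≤ ∑ z ∈ S, 2 ^ Fintype.card ι * q z := by
    have h2 := (Finset.card_le_card hcover).trans Finset.card_biUnion_le
    have h3 : ((Finset.univ : Finset (ι → Bool)).card : ℝ) = 2 ^ Fintype.card ι := by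
      simp
    rw [← h3]
    have h2' : ((Finset.univ : Finset (ι → Bool)).card : ℝ) ≤ ∑ z ∈ S,
        ((Finset.univ.filter fun σ : ι → Bool => t z < |signSum σ (y z)|).card : ℝ) := by
      exact_mod_cast h2
    refine h2'.trans (Finset.sum_le_sum fun z _ => ?_)
    rw [h3]
    exact hbad z
  rw [← Finset.mul_sum] at h1
  have h4 : (0 : ℝ) < 2 ^ Fintype.card ι := by positivity
  nlinarith [hsum S]

end RandomSigns

section SubProbability

/-- A nonnegative sequence all of whose finite sums are at most one. -/
def SubProb (f : ℕ → ℝ) : Prop := (∀ i, 0 ≤ f i) ∧ ∀ S : Finset ℕ, ∑ i ∈ S, f i ≤ 1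

lemma SubProb.le_one {f : ℕ → ℝ} (hf : SubProb f) (i : ℕ) : f i ≤ 1 := by
  simpa using hf.2 {i}

lemma SubProb.pair {f : ℕ → ℝ} {g : ℕ → ℕ → ℝ} (hf : SubProb f) (hg : ∀ i, SubProb (g i)) :
    SubProb fun x => f x.unpair.1 * g x.unpair.1 x.unpair.2 := by
  classical
  refine ⟨fun x => mul_nonneg (hf.1 _) ((hg _).1 _), fun S => ?_⟩
  set A := S.image fun x => x.unpair.1
  set B := S.image fun x => x.unpair.2
  calc ∑ x ∈ S, f x.unpair.1 * g x.unpair.1 x.unpair.2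
      = ∑ z ∈ S.image Nat.unpair, f z.1 * g z.1 z.2 := by
        rw [Finset.sum_image fun x _ y _ h => by
          rw [← Nat.pair_unpair x, ← Nat.pair_unpair y, h]]
    _ ≤ ∑ z ∈ A ×ˢ B, f z.1 * g z.1 z.2 := by
        refine Finset.sum_le_sum_of_subset_of_nonneg (fun z hz => ?_) fun z _ _ =>
          mul_nonneg (hf.1 _) ((hg _).1 _)
        obtain ⟨x, hx, rfl⟩ := Finset.mem_image.1 hz
        exact Finset.mem_product.2 ⟨Finset.mem_image_of_mem _ hx, Finset.mem_image_of_mem _ hx⟩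
    _ = ∑ x ∈ A, f x * ∑ y ∈ B, g x y := by
        rw [Finset.sum_product]
        simp only [Finset.mul_sum]
    _ ≤ ∑ x ∈ A, f x := Finset.sum_le_sum fun x _ =>
        mul_le_of_le_one_right (hf.1 x) ((hg x).2 B)
    _ ≤ 1 := hf.2 A

lemma subProb_geometric : SubProb fun j => (1 / 2 : ℝ) ^ (j + 1) := by
  refine ⟨fun j => by positivity, fun S => ?_⟩
  have h1 : HasSum (fun j => (1 / 2 : ℝ) ^ (j + 1)) 1 := by
    have h := hasSum_geometric_two.mul_left (1 / 2 : ℝ)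
    simp_rw [← pow_succ'] at h
    norm_num at h ⊢
    exact h
  exact sum_le_hasSum S (fun j _ => by positivity) h1

lemma subProb_uniform {x : ℝ} (hx : 0 < x) :
    SubProb fun i => if (i : ℝ) + 1 ≤ x then x⁻¹ else 0 := by
  refine ⟨fun i => by positivity, fun S => ?_⟩
  rw [← Finset.sum_filter, Finset.sum_const, nsmul_eq_mul, ← div_eq_mul_inv, div_le_one hx]
  have h1 : (S.filter fun i : ℕ => (i : ℝ) + 1 ≤ x) ⊆ Finset.range ⌊x⌋₊ := by
    intro i hi
    rw [Finset.mem_range]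
    have := (Finset.mem_filter.1 hi).2
    exact Nat.lt_of_succ_le (Nat.le_floor (by push_cast; exact this))
  have h2 := Finset.card_le_card h1
  rw [Finset.card_range] at h2
  exact (Nat.cast_le.2 h2).trans (Nat.floor_le hx.le)

end SubProbability

section Chaining

variable {ι : Type*} [Fintype ι]

/-- Generic chaining over a tree of labellings, with signs chosen by a union bound. -/
lemma exists_signs_chaining {V : Type*} (T : Set V) (X : V → ι → ℝ) (ρ : ℕ → ℝ)
    (hρ : ∀ k, 0 < ρ k) (L : ℕ → V → ℕ) (p : ℕ → ℕ → ℝ) (hp : ∀ k, SubProb (p k))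
    (hpos : ∀ k, ∀ v ∈ T, 0 < p k (L k v))
    (href : ∀ k v v', L (k + 1) v = L (k + 1) v' → L k v = L k v')
    (hcell : ∀ k, ∀ v ∈ T, ∀ v' ∈ T, L k v = L k v' → ∑ i, (X v i - X v' i) ^ 2 ≤ ρ k)
    (o : V) (ho : o ∈ T) (hXo : ∀ i, X o i = 0) (hL0 : ∀ v v', L 0 v = L 0 v') (K : ℕ) :
    ∃ σ : ι → Bool, ∀ v ∈ T, |signSum σ (X v)| ≤ Real.sqrt (Fintype.card ι * ρ K) +
      ∑ k ∈ Finset.range K,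
        Real.sqrt (2 * ρ k * (-Real.log (p (k + 1) (L (k + 1) v)) + (k + 3))) := by
  classical
  have hrep : ∀ k l, ∃ u ∈ T, (L k o = l → u = o) ∧ ((∃ v ∈ T, L k v = l) → L k u = l) := by
    intro k l
    by_cases h1 : L k o = l
    · exact ⟨o, ho, fun _ => rfl, fun _ => h1⟩
    · by_cases h2 : ∃ v ∈ T, L k v = l
      · obtain ⟨v, hv, hvl⟩ := h2
        exact ⟨v, hv, fun h => absurd h h1, fun _ => hvl⟩
      · exact ⟨o, ho, fun h => absurd h h1, fun h => absurd h h2⟩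
  choose rep hrepT hrepo hrepL using hrep
  let Z := {z : ℕ × ℕ // ∃ v ∈ T, L (z.1 + 1) v = z.2}
  let y : Z → ι → ℝ := fun z i =>
    X (rep (z.1.1 + 1) z.1.2) i - X (rep z.1.1 (L z.1.1 (rep (z.1.1 + 1) z.1.2))) i
  have hzpos : ∀ z : Z, 0 < p (z.1.1 + 1) z.1.2 := by
    rintro ⟨⟨k, l⟩, hz⟩
    obtain ⟨v, hv, h⟩ := hz
    have := hpos (k + 1) v hv
    simp only at h ⊢
    rwa [h] at this
  obtain ⟨σ, hσ⟩ := exists_signs y (fun z => ρ z.1.1)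
    (fun z => Real.sqrt (2 * ρ z.1.1 * (-Real.log (p (z.1.1 + 1) z.1.2) + (z.1.1 + 3))))
    (fun z => p (z.1.1 + 1) z.1.2 * (1 / 2) ^ (z.1.1 + 2)) (fun z => hρ _)
    (fun z => Real.sqrt_nonneg _)
    (fun z => hcell _ _ (hrepT _ _) _ (hrepT _ _) (hrepL _ _ ⟨_, hrepT _ _, rfl⟩).symm)
    (fun z => by
      have h1 := Real.log_nonpos (hzpos z).le ((hp _).le_one z.1.2)
      have h2 : 0 ≤ -Real.log (p (z.1.1 + 1) z.1.2) + (z.1.1 + 3) := by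
        have : (0 : ℝ) ≤ z.1.1 := Nat.cast_nonneg _
        linarith
      have h3 := hρ z.1.1
      rw [Real.sq_sqrt (by positivity), neg_div, mul_div_cancel_left₀ _ (by positivity), neg_add,
        neg_neg, Real.exp_add, Real.exp_log (hzpos z)]
      have h4 : Real.exp (-((z.1.1 : ℝ) + 3)) ≤ (1 / 2) ^ (z.1.1 + 3) := by
        have h5 : Real.exp (-1) ≤ 1 / 2 := by
          rw [Real.exp_neg, one_div]
          exact inv_anti₀ (by norm_num) (by linarith [Real.add_one_le_exp (1 : ℝ)])
        have h6 : Real.exp (-((z.1.1 : ℝ) + 3)) = Real.exp (-1) ^ (z.1.1 + 3) := by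
          rw [← Real.exp_nat_mul]; congr 1; push_cast; ring
        rw [h6]
        gcongr
      have h7 := mul_le_mul_of_nonneg_left h4 (hzpos z).le
      calc _ ≤ 2 * (p (z.1.1 + 1) z.1.2 * (1 / 2) ^ (z.1.1 + 3)) := by linarith
        _ = _ := by rw [pow_succ (1 / 2 : ℝ) (z.1.1 + 2)]; ring)
    (fun S => by
      set A := S.image fun z => z.1.1
      set B := S.image fun z => z.1.2
      have h1 : ∑ z ∈ S, p (z.1.1 + 1) z.1.2 * (1 / 2) ^ (z.1.1 + 2) ≤
          ∑ z ∈ A ×ˢ B, p (z.1 + 1) z.2 * (1 / 2) ^ (z.1 + 2) := by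
        rw [← Finset.sum_image (s := S) (g := fun z : Z => z.1)
          (f := fun z : ℕ × ℕ => p (z.1 + 1) z.2 * (1 / 2) ^ (z.1 + 2))
          (fun x _ y _ h => Subtype.ext h)]
        refine Finset.sum_le_sum_of_subset_of_nonneg (fun z hz => ?_) fun z _ _ =>
          mul_nonneg ((hp _).1 _) (by positivity)
        obtain ⟨x, hx, rfl⟩ := Finset.mem_image.1 hz
        exact Finset.mem_product.2 ⟨Finset.mem_image_of_mem _ hx, Finset.mem_image_of_mem _ hx⟩
      have h2 : ∑ z ∈ A ×ˢ B, p (z.1 + 1) z.2 * (1 / 2 : ℝ) ^ (z.1 + 2) ≤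
          ∑ k ∈ A, (1 / 2 : ℝ) ^ (k + 1) * (1 / 2) := by
        rw [Finset.sum_product]
        refine Finset.sum_le_sum fun k _ => ?_
        change ∑ l ∈ B, p (k + 1) l * (1 / 2 : ℝ) ^ (k + 2) ≤ _
        rw [← Finset.sum_mul, ← pow_succ]
        exact mul_le_of_le_one_left (by positivity) ((hp _).2 B)
      have h3 := subProb_geometric.2 A
      rw [← Finset.sum_mul] at h2
      linarith)
  refine ⟨σ, fun v hv => ?_⟩
  let π : ℕ → V := fun k => rep k (L k v)
  have hπT : ∀ k, π k ∈ T := fun k => hrepT _ _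
  have hπL : ∀ k, L k (π k) = L k v := fun k => hrepL _ _ ⟨v, hv, rfl⟩
  have h0 : signSum σ (X (π 0)) = 0 := by
    have : π 0 = o := hrepo _ _ (hL0 _ _)
    rw [this]
    simp [signSum, hXo]
  have hstep : ∀ k, |signSum σ (X (π (k + 1))) - signSum σ (X (π k))| ≤
      Real.sqrt (2 * ρ k * (-Real.log (p (k + 1) (L (k + 1) v)) + (k + 3))) := by
    intro k
    have h1 := hσ ⟨(k, L (k + 1) v), v, hv, rfl⟩
    rw [signSum_sub]
    have h2 : L k (π (k + 1)) = L k v := href k _ _ (hπL (k + 1))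
    simp only [y] at h1
    have h3 : rep k (L k (rep (k + 1) (L (k + 1) v))) = π k := by
      change rep k (L k (π (k + 1))) = π k
      rw [h2]
    rw [h3] at h1
    exact h1
  have hend : |signSum σ (X v) - signSum σ (X (π K))| ≤ Real.sqrt (Fintype.card ι * ρ K) := by
    rw [signSum_sub]
    refine (abs_signSum_le _ _).trans (Real.sqrt_le_sqrt ?_)
    gcongr
    exact hcell K v hv _ (hπT K) (hπL K).symm
  have htel := Finset.sum_range_sub (fun k => signSum σ (X (π k))) K
  rw [h0, sub_zero] at htel
  calc |signSum σ (X v)| = |(signSum σ (X v) - signSum σ (X (π K))) + signSum σ (X (π K))| := by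
        rw [sub_add_cancel]
    _ ≤ |signSum σ (X v) - signSum σ (X (π K))| + |signSum σ (X (π K))| := abs_add_le _ _
    _ ≤ _ := by
      refine add_le_add hend ?_
      rw [← htel]
      exact (Finset.abs_sum_le_sum_abs _ _).trans (Finset.sum_le_sum fun k _ => hstep k)

end Chaining

lemma exists_dyadic_class {D : ℝ} (hD : D ≤ 4) (k : ℕ) :
    ∃ j ≤ k, D ≤ 4 / 2 ^ j ∧ (4 / 2 ^ j ≤ 2 * D ∨ j = k) := by
  induction k with
  | zero => exact ⟨0, le_rfl, by simpa using hD, Or.inr rfl⟩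
  | succ k ih =>
    obtain ⟨j, hj, h1, h2 | h2⟩ := ih
    · exact ⟨j, by omega, h1, Or.inl h2⟩
    · by_cases h3 : D ≤ 4 / 2 ^ (k + 1)
      · exact ⟨k + 1, le_rfl, h3, Or.inr rfl⟩
      · refine ⟨j, by omega, h1, Or.inl ?_⟩
        push Not at h3
        subst h2
        have : (4 : ℝ) / 2 ^ j = 2 * (4 / 2 ^ (j + 1)) := by rw [pow_succ]; field_simp
        linarith

section BalancedSigns

open MeasureTheory

variable {V : Type*} [NormedAddCommGroup V] [InnerProductSpace ℝ V] [FiniteDimensional ℝ V]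
  [MeasurableSpace V] [BorelSpace V] {ι : Type*} [Fintype ι]

/-- The geometric sequence of quasi-radii used in the chaining argument. -/
noncomputable def chainRadius (δ : ℝ) (k : ℕ) : ℝ := 200 * δ * 256 ^ 2 / 256 ^ k

/-- The drop of the minimal energy `normEnergy N (m τ v)` between two radii. -/
noncomputable def energyDrop (N : ι → Seminorm ℝ V) (m : ℝ → V → V) (δ : ℝ) (k : ℕ) (v : V) : ℝ :=
  normEnergy N (m (chainRadius δ (k + 4)) v) - normEnergy N (m (chainRadius δ k) v)

lemma chainRadius_pos {δ : ℝ} (hδ : 0 < δ) (k : ℕ) : 0 < chainRadius δ k := by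
  unfold chainRadius; positivity

lemma chainRadius_succ (δ : ℝ) (k : ℕ) : 256 * chainRadius δ (k + 1) = chainRadius δ k := by
  unfold chainRadius; rw [pow_succ (256 : ℝ) k]; field_simp

lemma sum_geometric_weight_le (s : ℕ → ℝ) (hs : ∀ i, 0 ≤ s i) (K : ℕ) :
    ∑ k ∈ Finset.range K, (1 / 16 : ℝ) ^ k * ∑ i ∈ Finset.range (k + 1), s i ≤
      2 * ∑ i ∈ Finset.range K, (1 / 16 : ℝ) ^ i * s i := by
  suffices h : ∑ k ∈ Finset.range K, (1 / 16 : ℝ) ^ k * ∑ i ∈ Finset.range (k + 1), s i +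
      2 * ((1 / 16 : ℝ) ^ K * ∑ i ∈ Finset.range K, s i) ≤
      2 * ∑ i ∈ Finset.range K, (1 / 16 : ℝ) ^ i * s i by
    have h2 : 0 ≤ ∑ i ∈ Finset.range K, s i := Finset.sum_nonneg fun i _ => hs i
    have : 0 ≤ (1 / 16 : ℝ) ^ K * ∑ i ∈ Finset.range K, s i := by positivity
    linarith
  induction K with
  | zero => simp
  | succ K ih =>
    rw [Finset.sum_range_succ, Finset.sum_range_succ (fun i => (1 / 16 : ℝ) ^ i * s i),
      pow_succ (1 / 16 : ℝ) K, Finset.sum_range_succ s]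
    have h2 : 0 ≤ ∑ i ∈ Finset.range K, s i := Finset.sum_nonneg fun i _ => hs i
    have h3 : 0 ≤ (1 / 16 : ℝ) ^ K * ∑ i ∈ Finset.range K, s i := by positivity
    have h4 : 0 ≤ (1 / 16 : ℝ) ^ K * s K := mul_nonneg (by positivity) (hs K)
    nlinarith

lemma sqrt_add_le {x y : ℝ} (hx : 0 ≤ x) (hy : 0 ≤ y) :
    Real.sqrt (x + y) ≤ Real.sqrt x + Real.sqrt y := by
  refine Real.sqrt_le_iff.2 ⟨by positivity, ?_⟩
  nlinarith [Real.sq_sqrt hx, Real.sq_sqrt hy,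
    mul_nonneg (Real.sqrt_nonneg x) (Real.sqrt_nonneg y)]

lemma sqrt_sum_le {α : Type*} (S : Finset α) (f : α → ℝ) (hf : ∀ i ∈ S, 0 ≤ f i) :
    Real.sqrt (∑ i ∈ S, f i) ≤ ∑ i ∈ S, Real.sqrt (f i) := by
  classical
  induction S using Finset.induction_on with
  | empty => simp
  | insert x S hx ih =>
    simp only [Finset.mem_insert, forall_eq_or_imp] at hf
    rw [Finset.sum_insert hx, Finset.sum_insert hx]
    refine (sqrt_add_le hf.1 (Finset.sum_nonneg hf.2)).trans (by linarith [ih hf.2])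

lemma sum_range_geometric_le {x : ℝ} (hx0 : 0 ≤ x) (hx : x < 1) (K : ℕ) :
    ∑ i ∈ Finset.range K, x ^ i ≤ (1 - x)⁻¹ :=
  sum_le_hasSum _ (fun i _ => pow_nonneg hx0 i) (hasSum_geometric_of_lt_one hx0 hx)

lemma sum_geometric_mul_linear_le (K : ℕ) :
    ∑ k ∈ Finset.range K, (1 / 16 : ℝ) ^ k * (k + 3) ≤ 4 := by
  have h1 : ∀ k ∈ Finset.range K, (1 / 16 : ℝ) ^ k * (k + 3) ≤ 3 * (1 / 8) ^ k := by
    intro k _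
    have h2 : (k : ℝ) + 1 ≤ 2 ^ k := by exact_mod_cast Nat.lt_two_pow_self
    have h3 : (1 / 8 : ℝ) ^ k = (1 / 16) ^ k * 2 ^ k := by rw [← mul_pow]; norm_num
    rw [h3, mul_left_comm]
    gcongr
    have : (0 : ℝ) ≤ k := Nat.cast_nonneg k
    linarith
  refine (Finset.sum_le_sum h1).trans ?_
  rw [← Finset.mul_sum]
  have := sum_range_geometric_le (x := 1 / 8) (by norm_num) (by norm_num) K
  norm_num at this ⊢
  linarith

namespace IsBalanced

variable {N : ι → Seminorm ℝ V} {Ninf : Seminorm ℝ V} {δ n a b : ℝ}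

lemma exists_label_succ (hN : IsBalanced N Ninf δ n a b) (m : ℝ → V → V)
    (hm : ∀ τ v, 0 ≤ τ → quasiDist N (δ / n) (m τ v) v ≤ τ ∧
      ∀ u', quasiDist N (δ / n) u' v ≤ τ → normEnergy N (m τ v) ≤ normEnergy N u')
    (j : ℕ → V → ℕ)
    (hj : ∀ k v, normEnergy N v ≤ 3 → energyDrop N m δ k v ≤ 4 / 2 ^ j k v)
    (k : ℕ) (L : V → ℕ) (p : ℕ → ℝ) (hp : SubProb p)
    (hL : ∀ v v', normEnergy N v ≤ 3 → normEnergy N v' ≤ 3 → L v = L v' →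
      quasiDist N (δ / n) v v' ≤ chainRadius δ (k + 2)) :
    ∃ (L' : V → ℕ) (p' : ℕ → ℝ), SubProb p' ∧ (∀ v v', L' v = L' v' → L v = L v') ∧
      (∀ v v', normEnergy N v ≤ 3 → normEnergy N v' ≤ 3 → L' v = L' v' →
        quasiDist N (δ / n) v v' ≤ chainRadius δ (k + 3)) ∧
      ∀ v, normEnergy N v ≤ 3 → p (L v) * ((1 / 2) ^ (j k v + 2) *
        Real.exp (-(160000 * δ / chainRadius δ (k + 4) * (4 / 2 ^ j k v) *
          (a + 4 / 2 ^ j k v * b)))) ≤ p' (L' v) := by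
  classical
  have hρ := chainRadius_pos hN.pos (k + 4)
  have e3 : 256 * chainRadius δ (k + 4) = chainRadius δ (k + 3) := chainRadius_succ δ (k + 3)
  have e2 : 256 ^ 2 * chainRadius δ (k + 4) = chainRadius δ (k + 2) := by
    rw [← chainRadius_succ δ (k + 2), ← e3]; ring
  have e0 : 256 ^ 4 * chainRadius δ (k + 4) = chainRadius δ k := by
    rw [← chainRadius_succ δ k, ← chainRadius_succ δ (k + 1), ← e2]; ring
  have hrep : ∀ l, ∃ z, normEnergy N z ≤ 3 ∧ ∀ v, normEnergy N v ≤ 3 → L v = l → L z = l := by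
    intro l
    by_cases h : ∃ v, normEnergy N v ≤ 3 ∧ L v = l
    · obtain ⟨v, hv, hl⟩ := h
      exact ⟨v, hv, fun _ _ _ => hl⟩
    · exact ⟨0, by simp [normEnergy, energy], fun v hv hl => absurd ⟨v, hv, hl⟩ h⟩
  choose rep hrepT hrepL using hrep
  have hlab := fun (i : ℕ) (l : ℕ) => hN.exists_label m hm (ρ := chainRadius δ (k + 4))
    (β := 4 / 2 ^ i) hρ (by positivity) (rep l) (hrepT l)
  rw [e0, e2, e3] at hlab
  choose ℓ hℓ1 hℓ2 using hlab
  have hcell : ∀ v, normEnergy N v ≤ 3 →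
      quasiDist N (δ / n) v (rep (L v)) ≤ chainRadius δ (k + 2) := fun v hv =>
    hL _ _ hv (hrepT _) (hrepL _ v hv rfl).symm
  set x : ℕ → ℝ := fun i => 2 * Real.exp (160000 * δ / chainRadius δ (k + 4) * (4 / 2 ^ i) *
          (a + 4 / 2 ^ i * b)) with hx
  have hx0 : ∀ i, 0 < x i := fun i => by positivity
  refine ⟨fun v => Nat.pair (L v) (Nat.pair (j k v) (ℓ (j k v) (L v) v)), _,
    hp.pair fun _ => subProb_geometric.pair fun i => subProb_uniform (hx0 i), ?_, ?_, ?_⟩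
  · intro v v' h
    exact (Nat.pair_eq_pair.1 h).1
  · intro v v' hv hv' h
    obtain ⟨h1, h2⟩ := Nat.pair_eq_pair.1 h
    obtain ⟨h3, h4⟩ := Nat.pair_eq_pair.1 h2
    have d1 := hj k v hv
    have d2 := hj k v' hv'
    have c2 := hcell v' hv'
    rw [← h1, ← h3] at h4
    rw [← h3] at d2
    rw [← h1] at c2
    exact hℓ2 _ _ v v' (hcell v hv) c2 d1 d2 h4
  · intro v hv
    have h1 := hℓ1 (j k v) (L v) v (hcell v hv) (hj k v hv)
    simp only [Nat.unpair_pair]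
    rw [if_pos h1]
    refine mul_le_mul_of_nonneg_left (le_of_eq ?_) (hp.1 _)
    simp only [hx]
    rw [mul_inv, ← Real.exp_neg, pow_succ (1 / 2 : ℝ) (j k v + 1)]
    ring

lemma energyDrop_nonneg (hN : IsBalanced N Ninf δ n a b) (m : ℝ → V → V)
    (hm : ∀ τ v, 0 ≤ τ → quasiDist N (δ / n) (m τ v) v ≤ τ ∧
      ∀ u', quasiDist N (δ / n) u' v ≤ τ → normEnergy N (m τ v) ≤ normEnergy N u')
    (k : ℕ) (v : V) : 0 ≤ energyDrop N m δ k v := by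
  have h4 := (hm _ v (chainRadius_pos hN.pos (k + 4)).le).1
  have h1 := chainRadius_succ δ k
  have h2 := chainRadius_succ δ (k + 1)
  have h3 := chainRadius_succ δ (k + 2)
  have h5 := chainRadius_succ δ (k + 3)
  have := chainRadius_pos hN.pos (k + 4)
  have := (hm _ v (chainRadius_pos hN.pos k).le).2 (m (chainRadius δ (k + 4)) v) (by linarith)
  unfold energyDrop
  linarith

lemma sum_energyDrop_le (hN : IsBalanced N Ninf δ n a b) (m : ℝ → V → V)
    (hm : ∀ τ v, 0 ≤ τ → quasiDist N (δ / n) (m τ v) v ≤ τ ∧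
      ∀ u', quasiDist N (δ / n) u' v ≤ τ → normEnergy N (m τ v) ≤ normEnergy N u')
    {v : V} (hv : normEnergy N v ≤ 3) (K : ℕ) :
    ∑ k ∈ Finset.range K, energyDrop N m δ k v ≤ 12 := by
  set e : ℕ → ℝ := fun k => normEnergy N (m (chainRadius δ k) v) with he
  have h0 : ∀ k, 0 ≤ e k := fun k => add_nonneg (sq_nonneg _) (energy_nonneg _ _)
  have h3 : ∀ k, e k ≤ 3 := fun k =>
    ((hm _ v (chainRadius_pos hN.pos k).le).2 v
      (by rw [quasiDist_self]; exact (chainRadius_pos hN.pos k).le)).trans hv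
  have h : ∑ k ∈ Finset.range K, energyDrop N m δ k v =
      e K + e (K + 1) + e (K + 2) + e (K + 3) - (e 0 + e 1 + e 2 + e 3) := by
    induction K with
    | zero => simp
    | succ K ih =>
      rw [Finset.sum_range_succ, ih]
      simp only [energyDrop, he]
      rw [show K + 1 + 1 = K + 2 from rfl, show K + 1 + 2 = K + 3 from rfl,
        show K + 1 + 3 = K + 4 from rfl]
      ring
  rw [h]
  linarith [h0 0, h0 1, h0 2, h0 3, h3 K, h3 (K + 1), h3 (K + 2), h3 (K + 3)]

lemma energyDrop_le (hN : IsBalanced N Ninf δ n a b) (m : ℝ → V → V)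
    (hm : ∀ τ v, 0 ≤ τ → quasiDist N (δ / n) (m τ v) v ≤ τ ∧
      ∀ u', quasiDist N (δ / n) u' v ≤ τ → normEnergy N (m τ v) ≤ normEnergy N u')
    {v : V} (hv : normEnergy N v ≤ 3) (k : ℕ) :
    energyDrop N m δ k v ≤ 38400 * n * (1 / 16) ^ k := by
  have hd := hN.pos
  have hn := hN.one_le_dim
  have r1 := chainRadius_pos hd k
  have r2 := chainRadius_pos hd (k + 4)
  have h1 := (hm _ v r2.le).2 v (by rw [quasiDist_self]; exact r2.le)
  obtain ⟨h2, h2'⟩ := hm _ v r1.le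
  have h3 := h2' v (by rw [quasiDist_self]; exact r1.le)
  have h4 := hN.normEnergy_sub_le hv (h3.trans hv) h2
  have h5 : Real.sqrt (chainRadius δ k / δ) ≤ 3840 * (1 / 16) ^ k := by
    apply Real.sqrt_le_iff.2 ⟨by positivity, ?_⟩
    have : (256 : ℝ) ^ k = 16 ^ k * 16 ^ k := by rw [← mul_pow]; norm_num
    unfold chainRadius
    rw [mul_pow, one_div, inv_pow, this]
    field_simp
    norm_num
  unfold energyDrop
  calc _ ≤ 10 * n * Real.sqrt (chainRadius δ k / δ) := by linarith
    _ ≤ 10 * n * (3840 * (1 / 16) ^ k) := by gcongr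
    _ = _ := by ring

/-- Labellings at all scales together with codeword probabilities. -/
lemma exists_levels (hN : IsBalanced N Ninf δ n a b) (m : ℝ → V → V)
    (hm : ∀ τ v, 0 ≤ τ → quasiDist N (δ / n) (m τ v) v ≤ τ ∧
      ∀ u', quasiDist N (δ / n) u' v ≤ τ → normEnergy N (m τ v) ≤ normEnergy N u') :
    ∃ (L : ℕ → V → ℕ) (p : ℕ → ℕ → ℝ), (∀ k, SubProb (p k)) ∧ (∀ v v', L 0 v = L 0 v') ∧
      (∀ k v v', L (k + 1) v = L (k + 1) v' → L k v = L k v') ∧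
      (∀ k v v', normEnergy N v ≤ 3 → normEnergy N v' ≤ 3 → L k v = L k v' →
        quasiDist N (δ / n) v v' ≤ chainRadius δ (k + 2)) ∧
      ∀ k v, normEnergy N v ≤ 3 → 0 < p k (L k v) ∧
        -Real.log (p k (L k v)) ≤ ∑ i ∈ Finset.range k, ((i : ℝ) + 2 +
          800 * 256 ^ (i + 2) * (2 * energyDrop N m δ i v + 4 / 2 ^ i) *
            (a + (2 * energyDrop N m δ i v + 4 / 2 ^ i) * b)) := by
  classical
  have hd := hN.pos
  have ha := hN.one_le_left
  have hb := hN.one_le_right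
  have hD4 : ∀ k v, normEnergy N v ≤ 3 → energyDrop N m δ k v ≤ 4 := by
    intro k v hv
    have r2 := chainRadius_pos hd (k + 4)
    have h1 := (hm _ v r2.le).2 v (by rw [quasiDist_self]; exact r2.le)
    have h2 : 0 ≤ normEnergy N (m (chainRadius δ k) v) :=
      add_nonneg (sq_nonneg _) (energy_nonneg _ _)
    unfold energyDrop
    linarith
  have hcls : ∀ k v, ∃ j ≤ k, normEnergy N v ≤ 3 → energyDrop N m δ k v ≤ 4 / 2 ^ j ∧
      (4 / 2 ^ j ≤ 2 * energyDrop N m δ k v ∨ j = k) := by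
    intro k v
    by_cases hv : normEnergy N v ≤ 3
    · obtain ⟨j, hj, h⟩ := exists_dyadic_class (hD4 k v hv) k
      exact ⟨j, hj, fun _ => h⟩
    · exact ⟨k, le_rfl, fun h => absurd h hv⟩
  choose j hjk hj using hcls
  let P : ℕ → (V → ℕ) × (ℕ → ℝ) → Prop := fun k s => SubProb s.2 ∧
    (∀ v v', normEnergy N v ≤ 3 → normEnergy N v' ≤ 3 → s.1 v = s.1 v' →
      quasiDist N (δ / n) v v' ≤ chainRadius δ (k + 2)) ∧
    ∀ v, normEnergy N v ≤ 3 → 0 < s.2 (s.1 v) ∧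
      -Real.log (s.2 (s.1 v)) ≤ ∑ i ∈ Finset.range k, ((i : ℝ) + 2 +
          800 * 256 ^ (i + 2) * (2 * energyDrop N m δ i v + 4 / 2 ^ i) *
            (a + (2 * energyDrop N m δ i v + 4 / 2 ^ i) * b))
  have hstep : ∀ k (s : {s // P k s}), ∃ s' : {s // P (k + 1) s},
      ∀ v v', s'.1.1 v = s'.1.1 v' → s.1.1 v = s.1.1 v' := by
    rintro k ⟨⟨L, p⟩, hp, hL, hlog⟩
    obtain ⟨L', p', hp', href, hL', hlow⟩ := hN.exists_label_succ m hm j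
      (fun k v hv => (hj k v hv).1) k L p hp hL
    refine ⟨⟨⟨L', p'⟩, hp', hL', fun v hv => ?_⟩, href⟩
    obtain ⟨hpos, hlg⟩ := hlog v hv
    simp only at hpos hlg ⊢
    have h1 := hlow v hv
    have h2 := (by positivity : 0 < p (L v) * ((1 / 2) ^ (j k v + 2) *
        Real.exp (-(160000 * δ / chainRadius δ (k + 4) * (4 / 2 ^ j k v) *
          (a + 4 / 2 ^ j k v * b)))))
    refine ⟨h2.trans_le h1, ?_⟩
    have h3 := Real.log_le_log h2 h1
    rw [Real.log_mul hpos.ne' (by positivity), Real.log_mul (by positivity) (by positivity),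
      Real.log_exp, Real.log_pow, one_div, Real.log_inv] at h3
    rw [Finset.sum_range_succ]
    have h4 : ((j k v + 2 : ℕ) : ℝ) * Real.log 2 ≤ k + 2 := by
      have h5 : ((j k v : ℕ) : ℝ) ≤ k := by exact_mod_cast hjk k v
      have h6 := Real.log_two_lt_d9
      have h7 := Real.log_two_gt_d9
      have h8 : (0 : ℝ) ≤ j k v := Nat.cast_nonneg _
      push_cast
      nlinarith
    have h9 : (4 : ℝ) / 2 ^ j k v ≤ 2 * energyDrop N m δ k v + 4 / 2 ^ k := by
      rcases (hj k v hv).2 with h | h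
      · have : (0 : ℝ) ≤ 4 / 2 ^ k := by positivity
        linarith
      · rw [h]
        linarith [hN.energyDrop_nonneg m hm k v]
    have h10 : 160000 * δ / chainRadius δ (k + 4) = 800 * 256 ^ (k + 2) := by
      unfold chainRadius
      rw [show k + 4 = (k + 2) + 2 from rfl, pow_add (256 : ℝ) (k + 2) 2]
      field_simp
      norm_num
    rw [h10] at h3
    have h11 : 800 * 256 ^ (k + 2) * (4 / 2 ^ j k v) * (a + 4 / 2 ^ j k v * b) ≤
        800 * 256 ^ (k + 2) * (2 * energyDrop N m δ k v + 4 / 2 ^ k) *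
          (a + (2 * energyDrop N m δ k v + 4 / 2 ^ k) * b) := by
      have := hN.energyDrop_nonneg m hm k v
      gcongr
    linarith
  have h0 : P 0 (fun _ => 0, fun i => if i = 0 then 1 else 0) := by
    refine ⟨⟨fun i => by positivity, fun S => ?_⟩, fun v v' hv hv' _ => ?_, fun v _ => by simp⟩
    · rw [Finset.sum_ite_eq']
      split_ifs <;> norm_num
    · refine (hN.quasiDist_le_of_normEnergy_le hv hv').trans_eq ?_
      unfold chainRadius
      field_simp
  choose F hF using hstep
  let seq : ∀ k, {s // P k s} := fun k => Nat.rec ⟨_, h0⟩ (fun k s => F k s) k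
  refine ⟨fun k => (seq k).1.1, fun k => (seq k).1.2, fun k => (seq k).2.1, fun _ _ => rfl,
    fun k => hF k (seq k), fun k => (seq k).2.2.1, fun k => (seq k).2.2.2⟩

end IsBalanced

lemma sum_sqrt_le_of_le_geometric {β : ℕ → ℝ} (hβ : ∀ i, 0 ≤ β i) {q : ℕ} (hq : 1 ≤ q)
    (hsum : ∀ K, ∑ i ∈ Finset.range K, β i ≤ 32) (htail : ∀ i, q ≤ i → β i ≤ 76804 / 2 ^ i)
    (K : ℕ) : ∑ i ∈ Finset.range K, Real.sqrt (β i) ≤ 1118 * Real.sqrt q := by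
  have h1 : ∀ i ∈ Finset.range K, Real.sqrt (β i) ≤
      (if i < q then Real.sqrt (β i) else 0) + 278 * (3 / 4) ^ i := by
    intro i _
    split_ifs with h
    · have : (0 : ℝ) ≤ 278 * (3 / 4) ^ i := by positivity
      linarith
    · rw [zero_add]
      refine Real.sqrt_le_iff.2 ⟨by positivity, (htail i (not_lt.1 h)).trans ?_⟩
      rw [mul_pow, ← pow_mul, mul_comm i 2, pow_mul, div_eq_mul_inv, ← inv_pow]
      gcongr <;> norm_num
  refine (Finset.sum_le_sum h1).trans ?_
  rw [Finset.sum_add_distrib, ← Finset.sum_filter, ← Finset.mul_sum]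
  have h2 := sum_range_geometric_le (x := 3 / 4) (by norm_num) (by norm_num) K
  set S := (Finset.range K).filter (· < q) with hS
  have h3 : (S.card : ℝ) ≤ q := by
    have : S ⊆ Finset.range q := fun i hi => Finset.mem_range.2 (Finset.mem_filter.1 hi).2
    exact_mod_cast (Finset.card_le_card this).trans_eq (Finset.card_range q)
  have h4 : (∑ i ∈ S, Real.sqrt (β i)) ^ 2 ≤ (6 * Real.sqrt q) ^ 2 := by
    have h5 := Finset.sum_mul_sq_le_sq_mul_sq S (fun _ => (1 : ℝ)) (fun i => Real.sqrt (β i))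
    simp only [one_mul, one_pow, Finset.sum_const, nsmul_eq_mul, mul_one,
      Real.sq_sqrt (hβ _)] at h5
    have h6 : ∑ i ∈ S, β i ≤ 32 :=
      (Finset.sum_le_sum_of_subset_of_nonneg (Finset.filter_subset _ _)
        fun i _ _ => hβ i).trans (hsum K)
    rw [mul_pow, Real.sq_sqrt (Nat.cast_nonneg q)]
    have : 0 ≤ ∑ i ∈ S, β i := Finset.sum_nonneg fun i _ => hβ i
    have hq0 : (0 : ℝ) ≤ q := Nat.cast_nonneg q
    calc _ ≤ (S.card : ℝ) * ∑ i ∈ S, β i := h5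
      _ ≤ q * 32 := by gcongr
      _ ≤ _ := by linarith
  have h7 := (abs_le_of_sq_le_sq' h4 (by positivity)).2
  have h8 : 1 ≤ Real.sqrt q := Real.one_le_sqrt.2 (by exact_mod_cast hq)
  norm_num at h2
  linarith

/-- The numerical part of the chaining bound. -/
lemma sum_chain_le {β : ℕ → ℝ} (hβ : ∀ i, 0 ≤ β i) {δ a b : ℝ} (hδ : 0 < δ) (ha : 1 ≤ a)
    (hb : 1 ≤ b) {q : ℕ} (hq : 1 ≤ q) (hsum : ∀ K, ∑ i ∈ Finset.range K, β i ≤ 32)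
    (htail : ∀ i, q ≤ i → β i ≤ 76804 / 2 ^ i) (K : ℕ) :
    ∑ k ∈ Finset.range K, Real.sqrt (2 * (1600 * δ / 256 ^ k) *
      (∑ i ∈ Finset.range (k + 1), ((i : ℝ) + 2 + 800 * 256 ^ (i + 2) * β i * (a + β i * b)) +
        (k + 3))) ≤ Real.sqrt δ * (684 + 846336 * (1118 * (Real.sqrt a * Real.sqrt q) +
          32 * Real.sqrt b)) := by
  have ha0 : 0 ≤ a := by linarith
  have hb0 : 0 ≤ b := by linarith
  have h16 : ∀ k : ℕ, (256 : ℝ) ^ k = (16 ^ k) ^ 2 := fun k => by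
    rw [← pow_mul, mul_comm, pow_mul]; norm_num
  set t : ℕ → ℝ := fun i => (i : ℝ) + 2 + 7424 * 16 ^ i *
    (Real.sqrt a * Real.sqrt (β i) + β i * Real.sqrt b) with ht
  have hinc0 : ∀ i : ℕ, 0 ≤ (i : ℝ) + 2 + 800 * 256 ^ (i + 2) * β i * (a + β i * b) := by
    intro i
    have := hβ i
    positivity
  have ht0 : ∀ i, 0 ≤ t i := fun i => by
    have := hβ i
    positivity
  have hinc : ∀ i : ℕ,
      Real.sqrt ((i : ℝ) + 2 + 800 * 256 ^ (i + 2) * β i * (a + β i * b)) ≤ t i := by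
    intro i
    have hbi := hβ i
    refine Real.sqrt_le_iff.2 ⟨ht0 i, ?_⟩
    set A := Real.sqrt a * Real.sqrt (β i)
    set B := β i * Real.sqrt b
    have hA : A ^ 2 = a * β i := by
      rw [mul_pow, Real.sq_sqrt ha0, Real.sq_sqrt hbi]
    have hB : B ^ 2 = β i ^ 2 * b := by rw [mul_pow, Real.sq_sqrt hb0]
    have hA0 : 0 ≤ A := by positivity
    have hB0 : 0 ≤ B := by positivity
    have h1 : 800 * 256 ^ (i + 2) * β i * (a + β i * b) =
        800 * 256 ^ 2 * (16 ^ i) ^ 2 * (A ^ 2 + B ^ 2) := by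
      rw [hA, hB, pow_add, h16 i]; ring
    rw [h1]
    set x : ℝ := 16 ^ i with hx
    have hx0 : 0 ≤ x := by positivity
    have hi : (0 : ℝ) ≤ i := Nat.cast_nonneg i
    simp only [ht]
    rw [← hx]
    have h2 : 0 ≤ x ^ 2 * (A * B) := by positivity
    have h3 : 0 ≤ ((i : ℝ) + 2) * (x * (A + B)) := by positivity
    have h4 : 0 ≤ x ^ 2 * (A ^ 2 + B ^ 2) := by positivity
    have h5 : ((i : ℝ) + 2 + 7424 * x * (A + B)) ^ 2 = ((i : ℝ) + 2) ^ 2 +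
        14848 * (((i : ℝ) + 2) * (x * (A + B))) + 7424 ^ 2 * (x ^ 2 * (A ^ 2 + B ^ 2)) +
        2 * 7424 ^ 2 * (x ^ 2 * (A * B)) := by ring
    rw [h5]
    nlinarith
  have hterm : ∀ k ∈ Finset.range K, Real.sqrt (2 * (1600 * δ / 256 ^ k) *
      (∑ i ∈ Finset.range (k + 1), ((i : ℝ) + 2 + 800 * 256 ^ (i + 2) * β i * (a + β i * b)) +
        (k + 3))) ≤ 57 * Real.sqrt δ * ((1 / 16) ^ k * ∑ i ∈ Finset.range (k + 1), t i +
          (1 / 16) ^ k * (k + 3)) := by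
    intro k _
    have hk0 : (0 : ℝ) ≤ k := Nat.cast_nonneg k
    rw [Real.sqrt_mul (by positivity)]
    have h1 : Real.sqrt (2 * (1600 * δ / 256 ^ k)) ≤ 57 * Real.sqrt δ * (1 / 16) ^ k := by
      refine Real.sqrt_le_iff.2 ⟨by positivity, ?_⟩
      rw [mul_pow, mul_pow, Real.sq_sqrt hδ.le, h16, one_div, inv_pow]
      field_simp
      norm_num
    have h2 : Real.sqrt (∑ i ∈ Finset.range (k + 1),
        ((i : ℝ) + 2 + 800 * 256 ^ (i + 2) * β i * (a + β i * b)) + (k + 3)) ≤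
        ∑ i ∈ Finset.range (k + 1), t i + (k + 3) := by
      refine (sqrt_add_le (Finset.sum_nonneg fun i _ => hinc0 i) (by positivity)).trans ?_
      refine add_le_add ((sqrt_sum_le _ _ fun i _ => hinc0 i).trans
        (Finset.sum_le_sum fun i _ => hinc i)) ?_
      exact Real.sqrt_le_iff.2 ⟨by positivity, by nlinarith⟩
    calc _ ≤ (57 * Real.sqrt δ * (1 / 16) ^ k) *
          (∑ i ∈ Finset.range (k + 1), t i + (k + 3)) := by gcongr
      _ = _ := by ring
  refine (Finset.sum_le_sum hterm).trans ?_
  rw [← Finset.mul_sum, Finset.sum_add_distrib]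
  have s1 := sum_geometric_weight_le t ht0 K
  have s2 := sum_geometric_mul_linear_le K
  have s3 : ∑ i ∈ Finset.range K, (1 / 16 : ℝ) ^ i * t i ≤
      4 + 7424 * (1118 * (Real.sqrt a * Real.sqrt q) + 32 * Real.sqrt b) := by
    have e1 : ∀ i ∈ Finset.range K, (1 / 16 : ℝ) ^ i * t i ≤ (1 / 16) ^ i * ((i : ℝ) + 3) +
        7424 * (Real.sqrt a * Real.sqrt (β i) + β i * Real.sqrt b) := by
      intro i _
      simp only [ht]
      have e2 : (1 / 16 : ℝ) ^ i * 16 ^ i = 1 := by rw [← mul_pow]; norm_num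
      have e3 : (0 : ℝ) ≤ (1 / 16) ^ i := by positivity
      calc _ = (1 / 16 : ℝ) ^ i * ((i : ℝ) + 2) + ((1 / 16 : ℝ) ^ i * 16 ^ i) * (7424 *
            (Real.sqrt a * Real.sqrt (β i) + β i * Real.sqrt b)) := by ring
        _ ≤ _ := by rw [e2]; linarith
    refine (Finset.sum_le_sum e1).trans ?_
    rw [Finset.sum_add_distrib, ← Finset.mul_sum, Finset.sum_add_distrib, ← Finset.mul_sum,
      ← Finset.sum_mul]
    have e4 := mul_le_mul_of_nonneg_left (sum_sqrt_le_of_le_geometric hβ hq hsum htail K)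
      (Real.sqrt_nonneg a)
    have e5 := mul_le_mul_of_nonneg_right (hsum K) (Real.sqrt_nonneg b)
    linarith
  have s4 : 57 * Real.sqrt δ * (∑ k ∈ Finset.range K, (1 / 16 : ℝ) ^ k *
      ∑ i ∈ Finset.range (k + 1), t i + ∑ k ∈ Finset.range K, (1 / 16 : ℝ) ^ k * (k + 3)) ≤
      57 * Real.sqrt δ * (2 * (4 + 7424 * (1118 * (Real.sqrt a * Real.sqrt q) +
        32 * Real.sqrt b)) + 4) := by
    gcongr
    linarith
  refine s4.trans_eq (by ring)

/-- A balanced family admits signs for which the signed square sum is uniformly small on the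
unit ball of the energy. -/
theorem IsBalanced.exists_signs {N : ι → Seminorm ℝ V} {Ninf : Seminorm ℝ V} {δ n a b : ℝ}
    (hN : IsBalanced N Ninf δ n a b) {q : ℕ} (hq : 1 ≤ q) (hn : n ≤ 2 ^ q) :
    ∃ σ : ι → Bool, ∀ v, normEnergy N v ≤ 3 → |signSum σ fun i => N i v ^ 2| ≤
      10 ^ 9 * Real.sqrt δ * (Real.sqrt a * Real.sqrt q + Real.sqrt b) := by
  have hd := hN.pos
  have ha := hN.one_le_left
  have hb := hN.one_le_right
  have hn1 := hN.one_le_dim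
  have hmin : ∀ (τ : ℝ) (v : V), ∃ u, 0 ≤ τ → quasiDist N (δ / n) u v ≤ τ ∧
      ∀ u', quasiDist N (δ / n) u' v ≤ τ → normEnergy N u ≤ normEnergy N u' := by
    intro τ v
    by_cases hτ : 0 ≤ τ
    · obtain ⟨u, hu⟩ := hN.exists_min τ hτ v
      exact ⟨u, fun _ => hu⟩
    · exact ⟨0, fun h => absurd h hτ⟩
  choose m hm using hmin
  obtain ⟨L, p, hp, hL0, href, hcell, hlog⟩ := hN.exists_levels m hm
  have hρ : ∀ k, 8 * chainRadius δ (k + 2) = 1600 * δ / 256 ^ k := by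
    intro k
    unfold chainRadius
    rw [pow_add]
    field_simp
    norm_num
  obtain ⟨K, hK⟩ := pow_unbounded_of_one_lt (1600 * (Fintype.card ι : ℝ))
    (show (1 : ℝ) < 256 by norm_num)
  obtain ⟨σ, hσ⟩ := exists_signs_chaining {v | normEnergy N v ≤ 3} (fun v i => N i v ^ 2)
    (fun k => 1600 * δ / 256 ^ k) (fun k => by positivity) L p hp (fun k v hv => (hlog k v hv).1)
    href
    (fun k v hv v' hv' h => (sum_sq_sub_sq_le_quasiDist N hN.div_pos.le v v').trans
      (by rw [← hρ]; linarith [hcell k v v' hv hv' h]))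
    0 (by simp [normEnergy, energy]) (fun i => by simp) hL0 K
  refine ⟨σ, fun v hv => (hσ v hv).trans ?_⟩
  set β : ℕ → ℝ := fun i => 2 * energyDrop N m δ i v + 4 / 2 ^ i with hβ
  have hβ0 : ∀ i, 0 ≤ β i := fun i => by
    have := hN.energyDrop_nonneg m hm i v
    positivity
  have hsum : ∀ K, ∑ i ∈ Finset.range K, β i ≤ 32 := by
    intro K
    have h1 := hN.sum_energyDrop_le m hm hv K
    have h2 := sum_range_geometric_le (x := 1 / 2) (by norm_num) (by norm_num) K
    have h3 : ∑ i ∈ Finset.range K, β i = 2 * ∑ i ∈ Finset.range K, energyDrop N m δ i v +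
        4 * ∑ i ∈ Finset.range K, (1 / 2 : ℝ) ^ i := by
      rw [Finset.mul_sum, Finset.mul_sum, ← Finset.sum_add_distrib]
      refine Finset.sum_congr rfl fun i _ => ?_
      rw [one_div, inv_pow]
      rfl
    norm_num at h2
    rw [h3]
    linarith
  have htail : ∀ i, q ≤ i → β i ≤ 76804 / 2 ^ i := by
    intro i hi
    have h1 := hN.energyDrop_le m hm hv i
    have h2 : n ≤ 2 ^ i := hn.trans (pow_le_pow_right₀ (by norm_num) hi)
    have h3 : (1 / 16 : ℝ) ^ i = 1 / 8 ^ i * (1 / 2 ^ i) := by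
      rw [one_div, inv_pow, show (16 : ℝ) = 8 * 2 by norm_num, mul_pow]
      field_simp
    have h4 : (2 : ℝ) ^ i ≤ 8 ^ i := pow_le_pow_left₀ (by norm_num) (by norm_num) i
    have h5 : n * (1 / 16) ^ i ≤ 1 / 2 ^ i := by
      rw [h3, ← mul_assoc]
      refine mul_le_of_le_one_left (by positivity) ?_
      rw [mul_one_div, div_le_one (by positivity)]
      exact h2.trans h4
    have h6 : (76804 : ℝ) / 2 ^ i = 76800 * (1 / 2 ^ i) + 4 / 2 ^ i := by ring
    simp only [hβ]
    rw [h6]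
    linarith
  have hchain := sum_chain_le hβ0 hd ha hb hq hsum htail K
  have hsq1 : 1 ≤ Real.sqrt a * Real.sqrt q := one_le_mul_of_one_le_of_one_le
    (Real.one_le_sqrt.2 ha) (Real.one_le_sqrt.2 (by exact_mod_cast hq))
  have hfirst : Real.sqrt (Fintype.card ι * (1600 * δ / 256 ^ K)) ≤ Real.sqrt δ := by
    refine Real.sqrt_le_sqrt ?_
    rw [← mul_div_assoc, div_le_iff₀ (by positivity)]
    nlinarith
  have hrest : ∑ k ∈ Finset.range K, Real.sqrt (2 * (1600 * δ / 256 ^ k) *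
      (-Real.log (p (k + 1) (L (k + 1) v)) + (k + 3))) ≤ _ :=
    (Finset.sum_le_sum fun k _ => Real.sqrt_le_sqrt (mul_le_mul_of_nonneg_left
      (add_le_add_left (hlog (k + 1) v hv).2 _) (by positivity))).trans hchain
  refine (add_le_add hfirst hrest).trans ?_
  have hs := Real.sqrt_nonneg δ
  have hsb := Real.sqrt_nonneg b
  have : Real.sqrt δ * (1 + (684 + 846336 * (1118 * (Real.sqrt a * Real.sqrt q) +
      32 * Real.sqrt b))) ≤
      Real.sqrt δ * (10 ^ 9 * (Real.sqrt a * Real.sqrt q + Real.sqrt b)) := by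
    gcongr
    linarith
  linarith

end BalancedSigns

section Halving

open MeasureTheory

lemma sqrt_smul_apply_sq {V : Type*} [NormedAddCommGroup V] [NormedSpace ℝ V]
    (p : Seminorm ℝ V) (c : NNReal) (v : V) :
    (NNReal.sqrt c • p) v ^ 2 = c * p v ^ 2 := by
  rw [_root_.smul_apply, NNReal.smul_def, smul_eq_mul, mul_pow]
  congr 1
  exact_mod_cast NNReal.sq_sqrt c

variable {V : Type*} [NormedAddCommGroup V] [InnerProductSpace ℝ V] [FiniteDimensional ℝ V]
  [MeasurableSpace V] [BorelSpace V] {ι : Type*} [Fintype ι]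

namespace IsBalanced

variable {N : ι → Seminorm ℝ V} {Ninf : Seminorm ℝ V} {δ n a b : ℝ}

lemma restrict_smul (hN : IsBalanced N Ninf δ n a b) (hcard : Fintype.card ι * δ ≤ 2 * n)
    (A : Finset ι) (k : ℕ) (hA : A.card * 2 ^ k ≤ Fintype.card ι) :
    IsBalanced (fun i : A => NNReal.sqrt (2 ^ k) • N i) (NNReal.sqrt (2 ^ k) • Ninf)
      (2 ^ k * δ) n a b where
  pos := mul_pos (by positivity) hN.pos
  one_le_dim := hN.one_le_dim
  finrank_le := hN.finrank_le
  one_le_left := hN.one_le_left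
  one_le_right := hN.one_le_right
  le_sup i v := by
    rw [_root_.smul_apply, _root_.smul_apply]
    gcongr
    exact hN.le_sup i v
  sup_sq_le v := by
    rw [sqrt_smul_apply_sq, mul_assoc]
    push_cast
    gcongr
    exact hN.sup_sq_le v
  gaussMean i := by
    simp only [sqrt_smul_apply_sq]
    rw [mul_assoc]
    push_cast
    exact (hN.gaussMean i).const_mul (by positivity)
  gaussMean_sup := by
    simp only [sqrt_smul_apply_sq]
    rw [mul_assoc]
    push_cast
    exact hN.gaussMean_sup.const_mul (by positivity)
  energy_le v := by
    have hd := hN.pos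
    unfold energy
    simp only [sqrt_smul_apply_sq]
    push_cast
    rw [← Finset.mul_sum]
    have h1 : ∑ i : A, N i v ^ 2 ≤ A.card * (δ * ‖v‖ ^ 2) := by
      have := Finset.sum_le_card_nsmul (Finset.univ : Finset A) (fun i => N i v ^ 2) _
        fun i _ => hN.sq_le i v
      simpa using this
    have h2 : ((A.card : ℝ) * 2 ^ k) ≤ Fintype.card ι := by exact_mod_cast hA
    calc (2 : ℝ) ^ k * ∑ i : A, N i v ^ 2 ≤ 2 ^ k * (A.card * (δ * ‖v‖ ^ 2)) := by gcongr
      _ = ((A.card : ℝ) * 2 ^ k) * (δ * ‖v‖ ^ 2) := by ring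
      _ ≤ Fintype.card ι * (δ * ‖v‖ ^ 2) := by gcongr
      _ = Fintype.card ι * δ * ‖v‖ ^ 2 := by ring
      _ ≤ _ := by gcongr

/-- Keeping the smaller of the two sign classes halves the index set. -/
lemma exists_half (hN : IsBalanced N Ninf δ n a b) (hcard : Fintype.card ι * δ ≤ 2 * n)
    {q : ℕ} (hq : 1 ≤ q) (hn : n ≤ 2 ^ q) (A : Finset ι) (k : ℕ)
    (hA : A.card * 2 ^ k ≤ Fintype.card ι) :
    ∃ B : Finset ι, B.card * 2 ^ (k + 1) ≤ Fintype.card ι ∧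
      ∀ v, ‖v‖ ^ 2 + 2 ^ k * ∑ i ∈ A, N i v ^ 2 ≤ 3 →
        |2 ^ (k + 1) * ∑ i ∈ B, N i v ^ 2 - 2 ^ k * ∑ i ∈ A, N i v ^ 2| ≤
          10 ^ 9 * Real.sqrt (2 ^ k * δ) * (Real.sqrt a * Real.sqrt q + Real.sqrt b) := by
  classical
  obtain ⟨σ, hσ⟩ := (hN.restrict_smul hcard A k hA).exists_signs hq hn
  let s : ι → Bool := fun i => if h : i ∈ A then σ ⟨i, h⟩ else true
  have hs : ∀ i : A, s i = σ i := fun i => by simp [s]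
  have hsplit : ∀ f : ι → ℝ, ∑ i ∈ A with s i = true, f i + ∑ i ∈ A with ¬ s i = true, f i =
      ∑ i ∈ A, f i := fun f => Finset.sum_filter_add_sum_filter_not A _ f
  have hsign : ∀ v, signSum σ (fun i : A => (NNReal.sqrt (2 ^ k) • N i) v ^ 2) =
      2 ^ k * (∑ i ∈ A with s i = true, N i v ^ 2 - ∑ i ∈ A with ¬ s i = true, N i v ^ 2) := by
    intro v
    unfold signSum
    simp only [sqrt_smul_apply_sq]
    push_cast
    have h1 : ∑ i : A, boolSign (σ i) * (2 ^ k * N i v ^ 2) =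
        ∑ i ∈ A, 2 ^ k * (boolSign (s i) * N i v ^ 2) := by
      rw [← Finset.sum_coe_sort A]
      refine Finset.sum_congr rfl fun i _ => ?_
      rw [hs]; ring
    rw [h1, ← Finset.mul_sum, ← hsplit, sub_eq_add_neg, ← Finset.sum_neg_distrib]
    congr 2
    · refine Finset.sum_congr rfl fun i hi => ?_
      simp [boolSign, (Finset.mem_filter.1 hi).2]
    · refine Finset.sum_congr rfl fun i hi => ?_
      simp [boolSign, (Finset.mem_filter.1 hi).2]
  have hbd : ∀ v, ‖v‖ ^ 2 + 2 ^ k * ∑ i ∈ A, N i v ^ 2 ≤ 3 →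
      |2 ^ k * (∑ i ∈ A with s i = true, N i v ^ 2 - ∑ i ∈ A with ¬ s i = true, N i v ^ 2)| ≤
        10 ^ 9 * Real.sqrt (2 ^ k * δ) * (Real.sqrt a * Real.sqrt q + Real.sqrt b) := by
    intro v hv
    rw [← hsign]
    refine hσ v (le_trans (le_of_eq ?_) hv)
    unfold normEnergy energy
    simp only [sqrt_smul_apply_sq]
    push_cast
    rw [← Finset.mul_sum, Finset.sum_coe_sort A fun i => N i v ^ 2]
  have hcards := Finset.card_filter_add_card_filter_not (s := A) (fun i => s i = true)
  rw [pow_succ]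
  rcases le_total (A.filter fun i => s i = true).card (A.filter fun i => ¬ s i = true).card
    with h | h
  · refine ⟨A.filter fun i => s i = true, ?_, fun v hv => ?_⟩
    · refine le_trans ?_ hA
      rw [mul_comm (2 ^ k) 2, ← mul_assoc]
      exact Nat.mul_le_mul_right _ (by omega)
    · refine le_trans (le_of_eq ?_) (hbd v hv)
      rw [← hsplit fun i => N i v ^ 2]
      congr 1
      ring
  · refine ⟨A.filter fun i => ¬ s i = true, ?_, fun v hv => ?_⟩
    · refine le_trans ?_ hA
      rw [mul_comm (2 ^ k) 2, ← mul_assoc]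
      exact Nat.mul_le_mul_right _ (by omega)
    · refine le_trans (le_of_eq ?_) (hbd v hv)
      rw [← hsplit fun i => N i v ^ 2, ← abs_neg]
      congr 1
      ring

/-- Iterated halving of a balanced family. -/
theorem exists_subset (hN : IsBalanced N Ninf δ n a b) (hcard : Fintype.card ι * δ ≤ 2 * n)
    {q : ℕ} (hq : 1 ≤ q) (hn : n ≤ 2 ^ q) (K : ℕ)
    (hK : 3 * 10 ^ 9 * Real.sqrt (2 ^ K * δ) * (Real.sqrt a * Real.sqrt q + Real.sqrt b) ≤ 1) :
    ∃ A : Finset ι, A.card * 2 ^ K ≤ Fintype.card ι ∧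
      ∀ v, ‖v‖ ^ 2 ≤ 1 → energy N v ≤ 1 → |2 ^ K * ∑ i ∈ A, N i v ^ 2 - energy N v| ≤
        3 * 10 ^ 9 * Real.sqrt (2 ^ K * δ) * (Real.sqrt a * Real.sqrt q + Real.sqrt b) := by
  have hd := hN.pos
  set S := Real.sqrt a * Real.sqrt q + Real.sqrt b with hS
  have hS0 : 0 ≤ S := by positivity
  induction K with
  | zero =>
    refine ⟨Finset.univ, by simp, fun v _ _ => ?_⟩
    rw [pow_zero, one_mul, energy, sub_self, abs_zero]
    positivity
  | succ K ih =>
    have hstep : Real.sqrt (2 ^ (K + 1) * δ) = Real.sqrt 2 * Real.sqrt (2 ^ K * δ) := by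
      rw [← Real.sqrt_mul (by norm_num)]
      congr 1
      ring
    have h2 : 4 / 3 ≤ Real.sqrt 2 := Real.le_sqrt_of_sq_le (by norm_num)
    have hinc : 3 * 10 ^ 9 * Real.sqrt (2 ^ K * δ) * S + 10 ^ 9 * Real.sqrt (2 ^ K * δ) * S ≤
        3 * 10 ^ 9 * Real.sqrt (2 ^ (K + 1) * δ) * S := by
      rw [hstep]
      have : 0 ≤ Real.sqrt (2 ^ K * δ) * S := by positivity
      nlinarith
    have hpos : 0 ≤ 10 ^ 9 * Real.sqrt (2 ^ K * δ) * S := by positivity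
    obtain ⟨A, hA, hAe⟩ := ih (by linarith)
    obtain ⟨B, hB, hBe⟩ := hN.exists_half hcard hq hn A K hA
    refine ⟨B, hB, fun v hv hv' => ?_⟩
    have h3 := hAe v hv hv'
    have h4 := hBe v (by linarith [(abs_le.1 h3).2])
    refine (abs_sub_le _ (2 ^ K * ∑ i ∈ A, N i v ^ 2) _).trans ?_
    linarith

end IsBalanced

end Halving

section Leverage

lemma trace_nonpos_of_det_one_add_smul_le {m : Type*} [Fintype m] [DecidableEq m]
    {M : Matrix m m ℝ} (hM : ∀ t : ℝ, 0 < t → t ≤ 1 → (1 + t • M).det ≤ 1) : M.trace ≤ 0 := by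
  set p := (det (1 + (Polynomial.X : Polynomial ℝ) • M.map Polynomial.C)).divX.divX with hp
  have hlim : Filter.Tendsto (fun t : ℝ => M.trace + p.eval t * t)
      (nhdsWithin 0 (Set.Ioi 0)) (nhds M.trace) := by
    have hc : Continuous fun t : ℝ => M.trace + p.eval t * t := by fun_prop
    simpa using (hc.tendsto 0).mono_left nhdsWithin_le_nhds
  refine le_of_tendsto hlim ?_
  filter_upwards [Ioc_mem_nhdsGT (one_pos : (0 : ℝ) < 1)] with t ht
  have h1 := hM t ht.1 ht.2
  rw [det_one_add_smul, ← hp] at h1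
  have h2 : t * (M.trace + p.eval t * t) ≤ 0 := by linarith
  exact nonpos_of_mul_nonpos_right h2 ht.1

/-- Effective resistances for an optimal weighting of choices of one vector from each set `P e`. -/
lemma exists_posDef_leverage {n : ℕ} {κ : Type*} [Fintype κ] [DecidableEq κ]
    (P : κ → Finset (Fin n → ℝ)) (hP : ∀ e, (P e).Nonempty) (w : κ → ℝ) (hw : ∀ e, 0 ≤ w e)
    {η : ℝ} (hη : 0 < η) :
    ∃ G : Matrix (Fin n) (Fin n) ℝ, G.PosDef ∧
      (∀ (x : Fin n → ℝ) (M : κ → ℝ), (∀ e, ∀ d ∈ P e, (d ⬝ᵥ x) ^ 2 ≤ M e) →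
        x ⬝ᵥ G *ᵥ x ≤ ∑ e, w e * M e + η * (x ⬝ᵥ x)) ∧
      ∃ τ : κ → ℝ, (∀ e, ∀ d ∈ P e, w e * (d ⬝ᵥ G⁻¹ *ᵥ d) ≤ τ e) ∧ ∑ e, τ e ≤ n := by
  classical
  let lap : (κ → Fin n → ℝ) → Matrix (Fin n) (Fin n) ℝ := fun φ =>
    ∑ e, w e • Matrix.vecMulVec (φ e) (φ e)
  let Λ : Set (Matrix (Fin n) (Fin n) ℝ) := convexHull ℝ (Set.image lap (Fintype.piFinset P : Set _))
  have hlap : ∀ φ x, x ⬝ᵥ lap φ *ᵥ x = ∑ e, w e * (φ e ⬝ᵥ x) ^ 2 := by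
    intro φ x
    simp only [lap, Matrix.sum_mulVec, dotProduct_sum, Matrix.smul_mulVec, dotProduct_smul,
      smul_eq_mul, Matrix.vecMulVec_mulVec]
    refine Finset.sum_congr rfl fun e _ => ?_
    rw [op_smul_eq_smul, smul_eq_mul, dotProduct_comm x, sq]
  have hcomp : IsCompact Λ := ((Finset.finite_toSet _).image _).isCompact_convexHull ℝ
  obtain ⟨φ₀, hφ₀⟩ := Fintype.piFinset_nonempty.2 hP
  have hmem : ∀ φ, (∀ e, φ e ∈ P e) → lap φ ∈ Λ := fun φ hφ =>
    subset_convexHull ℝ _ ⟨φ, by simpa using hφ, rfl⟩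
  obtain ⟨L, hL, hmax⟩ := hcomp.exists_isMaxOn ⟨_, hmem φ₀ (by simpa using hφ₀)⟩
    (f := fun L : Matrix (Fin n) (Fin n) ℝ => (L + η • (1 : Matrix (Fin n) (Fin n) ℝ)).det)
    (Continuous.continuousOn (Continuous.matrix_det (by fun_prop)))
  have hsub : Λ ⊆ {L | L.PosSemidef ∧ ∀ (x : Fin n → ℝ) (M : κ → ℝ),
      (∀ e, ∀ d ∈ P e, (d ⬝ᵥ x) ^ 2 ≤ M e) → x ⬝ᵥ L *ᵥ x ≤ ∑ e, w e * M e} := by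
    refine convexHull_min ?_ ?_
    · rintro _ ⟨φ, hφ, rfl⟩
      refine ⟨Matrix.posSemidef_sum _ fun e _ => ?_, fun x M hM => ?_⟩
      · have := Matrix.posSemidef_vecMulVec_self_star (φ e)
        rw [star_trivial] at this
        exact this.smul (hw e)
      · rw [hlap]
        exact Finset.sum_le_sum fun e _ => mul_le_mul_of_nonneg_left
          (hM e _ (Fintype.mem_piFinset.1 (Finset.mem_coe.1 hφ) e)) (hw e)
    · rintro A ⟨hA, hA'⟩ B ⟨hB, hB'⟩ s t hs ht hst
      refine ⟨(hA.smul hs).add (hB.smul ht), fun x M hM => ?_⟩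
      rw [Matrix.add_mulVec, dotProduct_add, Matrix.smul_mulVec, Matrix.smul_mulVec,
        dotProduct_smul, dotProduct_smul, smul_eq_mul, smul_eq_mul]
      calc _ ≤ s * (∑ e, w e * M e) + t * (∑ e, w e * M e) := by
            gcongr
            · exact hA' x M hM
            · exact hB' x M hM
        _ = _ := by rw [← add_mul, hst, one_mul]
  obtain ⟨hLpsd, hLle⟩ := hsub hL
  set G := L + η • (1 : Matrix (Fin n) (Fin n) ℝ) with hG
  have hGpd : G.PosDef := Matrix.PosDef.posSemidef_add hLpsd (Matrix.PosDef.one.smul hη)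
  have hdet : 0 < G.det := hGpd.det_pos
  have hGG : G⁻¹ * G = 1 := Matrix.nonsing_inv_mul _ (isUnit_iff_ne_zero.2 hdet.ne')
  have hGG' : G * G⁻¹ = 1 := Matrix.mul_nonsing_inv _ (isUnit_iff_ne_zero.2 hdet.ne')
  refine ⟨G, hGpd, fun x M hM => ?_, ?_⟩
  · rw [hG, Matrix.add_mulVec, dotProduct_add, Matrix.smul_mulVec, Matrix.one_mulVec,
      dotProduct_smul, smul_eq_mul]
    linarith [hLle x M hM]
  have hchoice := fun e => (P e).exists_max_image (fun d => d ⬝ᵥ G⁻¹ *ᵥ d) (hP e)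
  choose φ hφ hφmax using hchoice
  refine ⟨fun e => w e * (φ e ⬝ᵥ G⁻¹ *ᵥ φ e), fun e d hd =>
    mul_le_mul_of_nonneg_left (hφmax e d hd) (hw e), ?_⟩
  have htr : (G⁻¹ * (lap φ - L)).trace ≤ 0 := by
    refine trace_nonpos_of_det_one_add_smul_le fun t ht0 ht1 => ?_
    have h1 : L + t • (lap φ - L) ∈ Λ :=
      (convex_convexHull ℝ _).add_smul_sub_mem hL (hmem φ hφ) ⟨ht0.le, ht1⟩
    have h2 := hmax h1
    simp only [Set.mem_ofPred_eq] at h2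
    have h3 : L + t • (lap φ - L) + η • (1 : Matrix (Fin n) (Fin n) ℝ) =
        G * (1 + t • (G⁻¹ * (lap φ - L))) := by
      rw [mul_add, mul_one, Matrix.mul_smul, ← mul_assoc, hGG', one_mul, hG]
      abel
    rw [h3, Matrix.det_mul, ← hG] at h2
    exact le_of_mul_le_mul_left (by linarith) hdet
  have h4 : (G⁻¹ * lap φ).trace = ∑ e, w e * (φ e ⬝ᵥ G⁻¹ *ᵥ φ e) := by
    simp only [lap, Matrix.mul_sum, Matrix.trace_sum, Matrix.mul_smul, Matrix.trace_smul,
      smul_eq_mul, Matrix.mul_vecMulVec, Matrix.trace_vecMulVec]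
    exact Finset.sum_congr rfl fun e _ => by rw [dotProduct_comm]
  have h5 : (G⁻¹ * L).trace ≤ n := by
    have : L = G - η • (1 : Matrix (Fin n) (Fin n) ℝ) := by rw [hG]; abel
    rw [this, mul_sub, hGG, Matrix.mul_smul, mul_one, Matrix.trace_sub, Matrix.trace_one,
      Matrix.trace_smul, smul_eq_mul, Fintype.card_fin]
    have := hGpd.inv.posSemidef.trace_nonneg
    nlinarith
  rw [mul_sub, Matrix.trace_sub, h4] at htr
  linarith

open scoped MatrixOrder in
/-- A positive definite form as a Euclidean norm, with dual vectors. -/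
lemma exists_isometry_of_posDef {n : ℕ} {G : Matrix (Fin n) (Fin n) ℝ} (hG : G.PosDef) :
    ∃ (T : (Fin n → ℝ) → EuclideanSpace ℝ (Fin n)) (u : (Fin n → ℝ) → EuclideanSpace ℝ (Fin n)),
      (∀ x, ‖T x‖ ^ 2 = x ⬝ᵥ G *ᵥ x) ∧ (∀ d x, inner ℝ (u d) (T x) = d ⬝ᵥ x) ∧
      ∀ d, ‖u d‖ ^ 2 = d ⬝ᵥ G⁻¹ *ᵥ d := by
  obtain ⟨B, hB, hGB⟩ := CStarAlgebra.isStrictlyPositive_iff_eq_star_mul_self.mp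
    hG.isStrictlyPositive
  rw [Matrix.star_eq_conjTranspose, Matrix.conjTranspose_eq_transpose_of_trivial] at hGB
  have hdet : IsUnit B.det := (Matrix.isUnit_iff_isUnit_det B).1 hB
  have hnorm : ∀ y : Fin n → ℝ, ‖WithLp.toLp 2 y‖ ^ 2 = y ⬝ᵥ y := by
    intro y
    rw [EuclideanSpace.norm_sq_eq]
    simp [dotProduct, sq]
  have hinner : ∀ y z : Fin n → ℝ, inner ℝ (WithLp.toLp 2 y) (WithLp.toLp 2 z) = y ⬝ᵥ z := by
    intro y z
    simp [PiLp.inner_apply, dotProduct, mul_comm]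
  refine ⟨fun x => WithLp.toLp 2 (B *ᵥ x), fun d => WithLp.toLp 2 (d ᵥ* B⁻¹),
    fun x => ?_, fun d x => ?_, fun d => ?_⟩
  · rw [hnorm, hGB, ← Matrix.mulVec_mulVec, Matrix.dotProduct_mulVec x, Matrix.vecMul_transpose]
  · rw [hinner, ← Matrix.dotProduct_mulVec, Matrix.mulVec_mulVec, Matrix.nonsing_inv_mul _ hdet,
      Matrix.one_mulVec]
  · rw [hnorm, hGB, Matrix.mul_inv_rev, ← Matrix.mulVec_mulVec, Matrix.dotProduct_mulVec d,
      ← Matrix.transpose_nonsing_inv, Matrix.mulVec_transpose]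

end Leverage

section SupSeminorm

variable {V : Type*} [NormedAddCommGroup V] [InnerProductSpace ℝ V]

/-- The seminorm `x ↦ max_{i ∈ S} |⟪a i, x⟫|`. -/
noncomputable def supSeminorm {κ : Type*} (S : Finset κ) (a : κ → V) : Seminorm ℝ V :=
  S.sup fun i => (innerₛₗ ℝ (a i)).toSeminorm

variable {κ : Type*} {S : Finset κ} {a : κ → V}

lemma abs_inner_le_supSeminorm {i : κ} (hi : i ∈ S) (x : V) :
    |inner ℝ (a i) x| ≤ supSeminorm S a x :=
  Seminorm.le_finset_sup_apply (p := fun i => (innerₛₗ ℝ (a i)).toSeminorm) (x := x) hi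

lemma supSeminorm_eq (S : Finset κ) (a : κ → V) (x : V) :
    supSeminorm S a x = 0 ∨ ∃ i ∈ S, supSeminorm S a x = |inner ℝ (a i) x| := by
  rcases S.eq_empty_or_nonempty with rfl | hS
  · left
    simp [supSeminorm]
  · right
    exact Seminorm.exists_apply_eq_finset_sup (fun i => (innerₛₗ ℝ (a i)).toSeminorm) hS x

lemma supSeminorm_sq_le {δ : ℝ} (hδ : 0 ≤ δ) (ha : ∀ i ∈ S, ‖a i‖ ^ 2 ≤ δ) (x : V) :
    supSeminorm S a x ^ 2 ≤ δ * ‖x‖ ^ 2 := by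
  rcases supSeminorm_eq S a x with h | ⟨i, hi, h⟩
  · rw [h, zero_pow two_ne_zero]
    positivity
  · rw [h]
    calc _ ≤ (‖a i‖ * ‖x‖) ^ 2 := pow_le_pow_left₀ (abs_nonneg _) (abs_real_inner_le_norm _ _) 2
      _ = ‖a i‖ ^ 2 * ‖x‖ ^ 2 := mul_pow _ _ _
      _ ≤ _ := by gcongr; exact ha i hi

lemma gaussMeanLE_supSeminorm_sq [FiniteDimensional ℝ V] [MeasurableSpace V] [BorelSpace V]
    {δ R : ℝ} (hδ : 0 < δ) (hR : 2 ≤ R) (hS : (S.card : ℝ) ≤ R) (ha : ∀ i ∈ S, ‖a i‖ ^ 2 ≤ δ) :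
    GaussMeanLE (fun x => supSeminorm S a x ^ 2) (16 * δ * Real.log R) :=
  gaussMeanLE_sup_sq S a hδ hR hS ha _ (supSeminorm_eq S a)

end SupSeminorm

section HyperedgeEnergy

variable {n : ℕ}

lemma dvec_dotProduct (i j : Fin n) (x : Fin n → ℝ) : dvec i j ⬝ᵥ x = x i - x j := by
  simp [dvec, dotProduct, sub_mul, Finset.sum_sub_distrib]

lemma sq_sub_le_Qe {e : Finset (Fin n)} {i j : Fin n} (hi : i ∈ e) (hj : j ∈ e)
    (x : Fin n → ℝ) : (x i - x j) ^ 2 ≤ Qe x e := by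
  unfold Qe
  refine le_ciSup_of_le (Set.finite_range _).bddAbove i ?_
  rw [ciSup_pos hi]
  refine le_ciSup_of_le (Set.finite_range _).bddAbove j ?_
  rw [ciSup_pos hj]

lemma Qe_le {e : Finset (Fin n)} {x : Fin n → ℝ} {c : ℝ} (hc : 0 ≤ c)
    (h : ∀ i ∈ e, ∀ j ∈ e, (x i - x j) ^ 2 ≤ c) : Qe x e ≤ c :=
  Real.iSup_le (fun i => Real.iSup_le (fun hi => Real.iSup_le (fun j => Real.iSup_le
    (fun hj => h i hi j hj) hc) hc) hc) hc

lemma Qe_nonneg (x : Fin n → ℝ) (e : Finset (Fin n)) : 0 ≤ Qe x e :=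
  Real.iSup_nonneg fun _ => Real.iSup_nonneg fun _ => Real.iSup_nonneg fun _ =>
    Real.iSup_nonneg fun _ => sq_nonneg _

end HyperedgeEnergy

section SupSeminormFamily

open Finset in
lemma IsBalanced.exists_of_smul {V : Type*} [NormedAddCommGroup V] [InnerProductSpace ℝ V]
    [FiniteDimensional ℝ V] [MeasurableSpace V] [BorelSpace V]
    {ι κ : Type*} [Fintype ι] [Fintype κ] {S : ι → Finset κ} {c : ι → ℝ} {u : κ → V}
    {δ n R R' : ℝ} (hδ : 0 < δ) (hn : 1 ≤ n) (hdim : (Module.finrank ℝ V : ℝ) ≤ n)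
    (hR : 2 ≤ R) (hS : ∀ i, ((S i).card : ℝ) ≤ R)
    (hR' : 2 ≤ R') (hκ : (Fintype.card κ : ℝ) ≤ R')
    (hc : ∀ i, 0 ≤ c i) (hcu : ∀ i, ∀ p ∈ S i, ‖c i • u p‖ ^ 2 ≤ δ)
    (hcard : Fintype.card ι * δ ≤ 2 * n) :
    ∃ Ninf, IsBalanced (fun i => supSeminorm (S i) fun p => c i • u p) Ninf δ n
      (16 * Real.log R) (16 * Real.log R') := by
  classical
  set m : κ → ℝ := fun p => ((univ.filter fun i => p ∈ S i).sup fun i => (c i).toNNReal : NNReal)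
    with hm
  have hm0 : ∀ p, 0 ≤ m p := fun p => NNReal.coe_nonneg _
  have hcm : ∀ i, ∀ p ∈ S i, c i ≤ m p := fun i p hp => by
    rw [← Real.coe_toNNReal (c i) (hc i)]
    exact_mod_cast Finset.le_sup (f := fun i => (c i).toNNReal) (by simpa using hp)
  have hmu : ∀ p, ‖m p • u p‖ ^ 2 ≤ δ := fun p => by
    rcases (univ.filter fun i => p ∈ S i).eq_empty_or_nonempty with h | h
    · have : m p = 0 := by simp [hm, h]
      simp [this, hδ.le]
    · obtain ⟨i, hi, h⟩ := exists_mem_eq_sup _ h fun i => (c i).toNNReal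
      have : m p = c i := by simp only [hm, h, Real.coe_toNNReal _ (hc i)]
      rw [this]
      exact hcu i p (by simpa using hi)
  have hlog : ∀ {R : ℝ}, 2 ≤ R → 1 ≤ 16 * Real.log R := fun hR => by
    have := Real.log_le_log two_pos hR
    linarith [Real.log_two_gt_d9]
  have hle : ∀ i v, supSeminorm (S i) (fun p => c i • u p) v
      ≤ supSeminorm univ (fun p => m p • u p) v := fun i v => by
    rcases supSeminorm_eq (S i) (fun p => c i • u p) v with h | ⟨p, hp, h⟩
    · rw [h]
      exact apply_nonneg _ _
    · rw [h]
      refine le_trans ?_ (abs_inner_le_supSeminorm (mem_univ p) v)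
      rw [real_inner_smul_left, real_inner_smul_left, abs_mul, abs_mul, abs_of_nonneg (hc i),
        abs_of_nonneg (hm0 p)]
      exact mul_le_mul_of_nonneg_right (hcm i p hp) (abs_nonneg _)
  have hsup : ∀ v, supSeminorm univ (fun p => m p • u p) v ^ 2 ≤ δ * ‖v‖ ^ 2 :=
    supSeminorm_sq_le hδ.le fun p _ => hmu p
  refine ⟨supSeminorm univ fun p => m p • u p, ⟨hδ, hn, hdim, hlog hR, hlog hR', hle, hsup,
    fun i => ?_, ?_, fun v => ?_⟩⟩
  · convert gaussMeanLE_supSeminorm_sq hδ hR (hS i) (hcu i) using 1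
    ring
  · convert gaussMeanLE_supSeminorm_sq hδ hR' (S := univ) (by simpa using hκ)
      (fun p _ => hmu p) using 1
    ring
  · calc energy _ v ≤ ∑ _i : ι, δ * ‖v‖ ^ 2 := sum_le_sum fun i _ =>
          (pow_le_pow_left₀ (apply_nonneg _ _) (hle i v) 2).trans (hsup v)
      _ = Fintype.card ι * δ * ‖v‖ ^ 2 := by simp [mul_assoc]
      _ ≤ _ := by gcongr

end SupSeminormFamily

section Regularized

open Finset

variable {n : ℕ}

lemma exists_sparsifier_regularized (hn : 2 ≤ n) (E : Finset (Finset (Fin n)))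
    (w : Finset (Fin n) → ℝ) (hE : ∀ e ∈ E, 2 ≤ e.card) (hw : ∀ e ∈ E, 0 ≤ w e) {r : ℕ}
    (hr2 : 2 ≤ r) (hr : ∀ e ∈ E, e.card ≤ r) {δ : ℝ} (hδ : 0 < δ) (hEδ : E.card * δ ≤ n)
    {q : ℕ} (hq : 1 ≤ q) (hnq : n ≤ 2 ^ q) (K : ℕ) {err : ℝ}
    (herr : err = 3 * 10 ^ 9 * Real.sqrt (2 ^ K * δ) *
      (Real.sqrt (32 * Real.log r) * Real.sqrt q + Real.sqrt (32 * Real.log n)))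
    (herr1 : err ≤ 1) {η : ℝ} (hη : 0 < η) :
    ∃ tw : Finset (Fin n) → ℝ,
      (∀ e, ∃ a ≤ ⌊2 * n / δ⌋₊, ∃ k ≤ ⌊2 * n / δ⌋₊,
        tw e = if e ∈ E then 2 ^ K * (a * (w e / k)) else 0) ∧
      ((E.filter fun e => 0 < tw e).card : ℝ) * (2 ^ K * δ) ≤ 2 * n ∧
      ∀ x, |QH E w x - QH E tw x| ≤ err * (QH E w x + η * (x ⬝ᵥ x)) := by
  classical
  let P : E → Finset (Fin n → ℝ) := fun e => (e.1 ×ˢ e.1).image fun p => dvec p.1 p.2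
  have hP : ∀ e, (P e).Nonempty := fun e => by
    have : e.1.Nonempty := card_pos.1 (by linarith [hE e.1 e.2])
    exact (this.product this).image _
  obtain ⟨G, hG, hGle, τ, hτ, hτn⟩ := exists_posDef_leverage P hP (fun e => w e)
    (fun e => hw e e.2) hη
  obtain ⟨T, u, hT, hu, hun⟩ := exists_isometry_of_posDef hG
  have hdmem : ∀ e : E, ∀ p ∈ e.1 ×ˢ e.1, dvec p.1 p.2 ∈ P e := fun e p hp =>
    mem_image_of_mem (fun p : Fin n × Fin n => dvec p.1 p.2) hp
  have hτ0 : ∀ e, 0 ≤ τ e := fun e => by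
    obtain ⟨d, hd⟩ := hP e
    refine le_trans ?_ (hτ e d hd)
    rw [← hun]
    exact mul_nonneg (hw e e.2) (sq_nonneg _)
  let k : E → ℕ := fun e => ⌊τ e / δ⌋₊ + 1
  have hk : ∀ e, τ e / δ ≤ k e := fun e => by
    simpa [k] using (Nat.lt_floor_add_one (τ e / δ)).le
  have hk0 : ∀ e, (0 : ℝ) < k e := fun e => by positivity
  let c : E → ℝ := fun e => Real.sqrt (w e / k e)
  have hwk : ∀ e : E, 0 ≤ w e / k e := fun e => div_nonneg (hw e e.2) (hk0 e).le
  have hc2 : ∀ e, c e ^ 2 = w e / k e := fun e => Real.sq_sqrt (hwk e)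
  let v : Fin n × Fin n → EuclideanSpace ℝ (Fin n) := fun p => u (dvec p.1 p.2)
  let ι := Σ e : E, Fin (k e)
  have hcardι : (Fintype.card ι : ℝ) * δ ≤ 2 * n := by
    have h1 : (Fintype.card ι : ℝ) = ∑ e, (k e : ℝ) := by
      simp [ι, Fintype.card_sigma]
    have h2 : ∑ e, (k e : ℝ) * δ ≤ ∑ e, (τ e + δ) := by
      refine sum_le_sum fun e _ => ?_
      have := Nat.floor_le (div_nonneg (hτ0 e) hδ.le)
      rw [le_div_iff₀ hδ] at this
      simp only [k, Nat.cast_add, Nat.cast_one]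
      linarith
    rw [h1, sum_mul]
    refine h2.trans ?_
    rw [sum_add_distrib]
    simp only [sum_const, card_univ, Fintype.card_coe, nsmul_eq_mul]
    linarith
  have hn1 : (1 : ℝ) ≤ n := by exact_mod_cast (by omega : 1 ≤ n)
  have hsq2 : ∀ {m : ℕ}, 2 ≤ m → (2 : ℝ) ≤ (m : ℝ) ^ 2 := fun {m} h => by
    have : (2 : ℝ) ≤ m := by exact_mod_cast h
    nlinarith
  obtain ⟨Ninf, hN⟩ := IsBalanced.exists_of_smul (ι := ι) (S := fun i => i.1.1 ×ˢ i.1.1)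
    (c := fun i => c i.1) (u := v) (n := n) (R := (r : ℝ) ^ 2) (R' := (n : ℝ) ^ 2) hδ hn1
    (by simp) (hsq2 hr2)
    (fun i => by
      rw [card_product, ← sq]
      exact_mod_cast Nat.pow_le_pow_left (hr _ i.1.2) 2)
    (hsq2 hn) (by simp [sq]) (fun i => Real.sqrt_nonneg _)
    (fun i p hp => by
      rw [norm_smul, mul_pow, Real.norm_eq_abs, sq_abs, hc2, hun, div_mul_eq_mul_div,
        div_le_iff₀ (hk0 _)]
      refine (hτ _ _ (hdmem _ p hp)).trans ?_
      have := hk i.1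
      rw [div_le_iff₀ hδ] at this
      linarith)
    hcardι
  have hlog : ∀ m : ℕ, 16 * Real.log ((m : ℝ) ^ 2) = 32 * Real.log m := fun m => by
    rw [Real.log_pow]
    push_cast
    ring
  rw [hlog, hlog] at hN
  obtain ⟨A, hA, hAle⟩ := hN.exists_subset hcardι hq (by exact_mod_cast hnq) K (herr ▸ herr1)
  rw [← herr] at hAle
  have hNT : ∀ (e : E) (x : Fin n → ℝ),
      supSeminorm (e.1 ×ˢ e.1) (fun p => c e • v p) (T x) ^ 2 = w e / k e * Qe x e := by
    intro e x
    have hin : ∀ p : Fin n × Fin n, inner ℝ (c e • v p) (T x) = c e * (x p.1 - x p.2) := fun p => by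
      rw [real_inner_smul_left, hu, dvec_dotProduct]
    refine le_antisymm ?_ ?_
    · rcases supSeminorm_eq (e.1 ×ˢ e.1) (fun p => c e • v p) (T x) with h | ⟨p, hp, h⟩
      · rw [h, zero_pow two_ne_zero]
        exact mul_nonneg (hwk e) (Qe_nonneg _ _)
      · rw [h, hin, sq_abs, mul_pow, hc2]
        exact mul_le_mul_of_nonneg_left
          (sq_sub_le_Qe (mem_product.1 hp).1 (mem_product.1 hp).2 x) (hwk e)
    · rcases (hwk e).eq_or_lt with h0 | h0
      · rw [← h0, zero_mul]
        positivity
      · rw [mul_comm, ← le_div_iff₀ h0]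
        refine Qe_le (by positivity) fun i hi j hj => ?_
        rw [le_div_iff₀ h0, ← hc2, ← mul_pow, mul_comm, ← hin (i, j), ← sq_abs]
        exact pow_le_pow_left₀ (abs_nonneg _)
          (abs_inner_le_supSeminorm (a := fun p => c e • v p) (mk_mem_product hi hj) _) 2
  have hfib : ∀ (B : Finset ι) (x : Fin n → ℝ),
      ∑ i ∈ B, supSeminorm (i.1.1 ×ˢ i.1.1) (fun p => c i.1 • v p) (T x) ^ 2
        = ∑ e : E, ((B.filter fun i => i.1 = e).card : ℝ) * (w e / k e * Qe x e) := fun B x => by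
    simp_rw [hNT]
    rw [← sum_fiberwise' B (fun i => i.1) fun e : E => w e / k e * Qe x e]
    simp
  have hfull : ∀ x, energy (fun i : ι => supSeminorm (i.1.1 ×ˢ i.1.1) fun p => c i.1 • v p) (T x)
      = QH E w x := fun x => by
    rw [energy, hfib, QH, ← sum_coe_sort E]
    refine sum_congr rfl fun e _ => ?_
    have : (univ.filter fun i : ι => i.1 = e).card = k e := by
      have : (univ.filter fun i : ι => i.1 = e) = univ.map (Function.Embedding.sigmaMk e) := by
        ext ⟨e', j⟩
        simp only [mem_filter, mem_univ, true_and, mem_map]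
        constructor
        · rintro rfl
          exact ⟨j, rfl⟩
        · rintro ⟨j', h⟩
          exact (congrArg Sigma.fst h).symm
      rw [this, card_map, card_univ, Fintype.card_fin]
    rw [this, ← mul_assoc, mul_div_cancel₀ _ (hk0 e).ne']
  let a : E → ℕ := fun e => (A.filter fun i => i.1 = e).card
  let tw : Finset (Fin n) → ℝ := fun e =>
    if h : e ∈ E then 2 ^ K * (a ⟨e, h⟩ * (w e / k ⟨e, h⟩)) else 0
  have htw : ∀ e : E, tw e = 2 ^ K * (a e * (w e / k e)) := fun e => by simp [tw]
  have hsub : ∀ x, 2 ^ K * ∑ i ∈ A, supSeminorm (i.1.1 ×ˢ i.1.1) (fun p => c i.1 • v p) (T x) ^ 2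
      = QH E tw x := fun x => by
    rw [hfib, QH, ← sum_coe_sort E, mul_sum]
    refine sum_congr rfl fun e _ => ?_
    rw [htw]
    ring
  have hιM : Fintype.card ι ≤ ⌊2 * n / δ⌋₊ := Nat.le_floor ((le_div_iff₀ hδ).2 hcardι)
  refine ⟨tw, fun e => ?_, ?_, fun x => ?_⟩
  · by_cases h : e ∈ E
    · refine ⟨a ⟨e, h⟩, ((card_le_card (filter_subset _ _)).trans (card_le_univ A)).trans hιM,
        k ⟨e, h⟩, le_trans ?_ hιM, by simp [tw, h]⟩
      rw [Fintype.card_sigma]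
      simpa using single_le_sum (f := k) (fun _ _ => Nat.zero_le _) (mem_univ (⟨e, h⟩ : E))
    · exact ⟨0, Nat.zero_le _, 0, Nat.zero_le _, by simp [tw, h]⟩
  · have h1 : (E.filter fun e => 0 < tw e).card ≤ A.card := by
      refine (card_le_card fun e he => ?_).trans (card_image_le (s := A) (f := fun i => i.1.1))
      obtain ⟨heE, he0⟩ := mem_filter.1 he
      have : (A.filter fun i => i.1 = ⟨e, heE⟩).Nonempty := by
        rw [nonempty_iff_ne_empty]
        intro h
        simp [tw, heE, a, h] at he0
      obtain ⟨i, hi⟩ := this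
      obtain ⟨hiA, hie⟩ := mem_filter.1 hi
      exact mem_image.2 ⟨i, hiA, by rw [hie]⟩
    calc ((E.filter fun e => 0 < tw e).card : ℝ) * (2 ^ K * δ) ≤ A.card * (2 ^ K * δ) := by
          gcongr
      _ = (A.card * 2 ^ K : ℕ) * δ := by push_cast; ring
      _ ≤ Fintype.card ι * δ := by gcongr
      _ ≤ 2 * n := hcardι
  · set s := QH E w x + η * (x ⬝ᵥ x) with hs
    have hQ0 : 0 ≤ QH E w x := sum_nonneg fun e he => mul_nonneg (hw e he) (Qe_nonneg _ _)
    have hxx : 0 ≤ x ⬝ᵥ x := sum_nonneg fun i _ => mul_self_nonneg _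
    have hTs : ‖T x‖ ^ 2 ≤ s := by
      rw [hT]
      refine (hGle x (fun e => Qe x e) fun e d hd => ?_).trans_eq ?_
      · obtain ⟨p, hp, rfl⟩ := mem_image.1 hd
        rw [dvec_dotProduct]
        exact sq_sub_le_Qe (mem_product.1 hp).1 (mem_product.1 hp).2 x
      · rw [hs, QH, ← sum_coe_sort E]
    rcases (add_nonneg hQ0 (mul_nonneg hη.le hxx)).eq_or_lt with h0 | h0
    · have h1 : ‖T x‖ = 0 := by
        rw [← hs] at h0
        rw [← h0] at hTs
        exact pow_eq_zero_iff two_ne_zero |>.1 (le_antisymm hTs (sq_nonneg _))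
      have h2 : T x = 0 := norm_eq_zero.1 h1
      rw [← hsub, ← hfull, h2, hs, ← h0]
      simp [energy]
    · rw [← hs] at h0
      set t := (Real.sqrt s)⁻¹ with ht
      have ht2 : t ^ 2 = s⁻¹ := by rw [ht, inv_pow, Real.sq_sqrt h0.le]
      have hsm : ∀ i : ι, supSeminorm (i.1.1 ×ˢ i.1.1) (fun p => c i.1 • v p) (t • T x) ^ 2
          = s⁻¹ * supSeminorm (i.1.1 ×ˢ i.1.1) (fun p => c i.1 • v p) (T x) ^ 2 := fun i => by
        rw [map_smul_eq_mul, mul_pow, Real.norm_eq_abs, sq_abs, ht2]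
      have hen : energy (fun i : ι => supSeminorm (i.1.1 ×ˢ i.1.1) fun p => c i.1 • v p) (t • T x)
          = s⁻¹ * QH E w x := by
        rw [← hfull, energy, energy, mul_sum]
        exact sum_congr rfl fun i _ => hsm i
      have := hAle (t • T x)
        (by
          rw [norm_smul, mul_pow, Real.norm_eq_abs, sq_abs, ht2, inv_mul_le_iff₀ h0, mul_one]
          exact hTs)
        (by
          rw [hen, inv_mul_le_iff₀ h0, mul_one, hs]
          exact le_add_of_nonneg_right (mul_nonneg hη.le hxx))
      rw [hen, sum_congr rfl fun i _ => hsm i, ← mul_sum, mul_left_comm, hsub, ← mul_sub, abs_mul,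
        abs_of_pos (inv_pos.2 h0), inv_mul_le_iff₀ h0] at this
      rw [abs_sub_comm]
      linarith

end Regularized

section Limit

open Filter Topology

variable {n : ℕ}

lemma exists_sparsifier_of_scale (hn : 2 ≤ n) (E : Finset (Finset (Fin n)))
    (w : Finset (Fin n) → ℝ) (hE : ∀ e ∈ E, 2 ≤ e.card) (hw : ∀ e ∈ E, 0 ≤ w e) {r : ℕ}
    (hr2 : 2 ≤ r) (hr : ∀ e ∈ E, e.card ≤ r) {δ : ℝ} (hδ : 0 < δ) (hEδ : E.card * δ ≤ n)
    {q : ℕ} (hq : 1 ≤ q) (hnq : n ≤ 2 ^ q) (K : ℕ) {err : ℝ}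
    (herr : err = 3 * 10 ^ 9 * Real.sqrt (2 ^ K * δ) *
      (Real.sqrt (32 * Real.log r) * Real.sqrt q + Real.sqrt (32 * Real.log n)))
    (herr1 : err ≤ 1) :
    ∃ tw : Finset (Fin n) → ℝ, (∀ e, 0 ≤ tw e) ∧ (∀ e, tw e ≠ 0 → e ∈ E) ∧
      ((E.filter fun e => 0 < tw e).card : ℝ) * (2 ^ K * δ) ≤ 2 * n ∧
      ∀ x, |QH E w x - QH E tw x| ≤ err * QH E w x := by
  let t : Finset (Fin n) → Set ℝ := fun e =>
    {y | ∃ a ≤ ⌊2 * n / δ⌋₊, ∃ k ≤ ⌊2 * n / δ⌋₊,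
      y = if e ∈ E then 2 ^ K * (a * (w e / k)) else 0}
  have ht : ∀ e, (t e).Finite := fun e => by
    refine (((Set.finite_Iic ⌊2 * n / δ⌋₊).prod (Set.finite_Iic ⌊2 * n / δ⌋₊)).image
      fun p => if e ∈ E then 2 ^ K * ((p.1 : ℝ) * (w e / p.2)) else 0).subset ?_
    rintro y ⟨a, ha, k, hk, rfl⟩
    exact ⟨(a, k), ⟨ha, hk⟩, rfl⟩
  have ht0 : ∀ e, ∀ y ∈ t e, 0 ≤ y ∧ (y ≠ 0 → e ∈ E) := by
    rintro e y ⟨a, -, k, -, rfl⟩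
    split_ifs with h
    · have := hw e h
      exact ⟨by positivity, fun _ => h⟩
    · simp
  by_contra! hcon
  have hfail : ∀ᶠ η in 𝓝[>] (0 : ℝ), ∀ tw ∈ {f : Finset (Fin n) → ℝ | ∀ e, f e ∈ t e},
      ((E.filter fun e => 0 < tw e).card : ℝ) * (2 ^ K * δ) ≤ 2 * n →
      ∃ x, err * (QH E w x + η * (x ⬝ᵥ x)) < |QH E w x - QH E tw x| := by
    rw [eventually_all_finite (Set.Finite.pi' ht)]
    intro tw htw
    by_cases hc : ((E.filter fun e => 0 < tw e).card : ℝ) * (2 ^ K * δ) ≤ 2 * n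
    · obtain ⟨x, hx⟩ := hcon tw (fun e => (ht0 e _ (htw e)).1) (fun e => (ht0 e _ (htw e)).2) hc
      have hcont : Continuous fun η : ℝ => err * (QH E w x + η * (x ⬝ᵥ x)) := by fun_prop
      have := (hcont.tendsto 0).eventually_lt_const (u := |QH E w x - QH E tw x|)
        (by simpa using hx)
      filter_upwards [nhdsWithin_le_nhds this] with η h _
      exact ⟨x, h⟩
    · exact Eventually.of_forall fun η h => absurd h hc
  obtain ⟨η, hη, hpos⟩ := (hfail.and self_mem_nhdsWithin).exists
  obtain ⟨tw, h1, h2, h3⟩ :=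
    exists_sparsifier_regularized hn E w hE hw hr2 hr hδ hEδ hq hnq K herr herr1 hpos
  obtain ⟨x, hx⟩ := hη tw h1 h2
  exact (h3 x).not_gt hx

end Limit

lemma clog_two_le_log {n : ℕ} (hn : 2 ≤ n) : (Nat.clog 2 n : ℝ) ≤ 4 * Real.log n := by
  have hl := Real.log_two_gt_d9
  have h2 : Real.log 2 ≤ Real.log n := Real.log_le_log two_pos (by exact_mod_cast hn)
  have h1 : 1 ≤ Nat.clog 2 n := Nat.clog_pos one_lt_two hn
  have h : (2 : ℝ) ^ (Nat.clog 2 n - 1) ≤ n := by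
    exact_mod_cast (Nat.pow_pred_clog_lt_self one_lt_two hn).le
  have := Real.log_le_log (by positivity) h
  rw [Real.log_pow, Nat.cast_sub h1, Nat.cast_one] at this
  have h1' : (1 : ℝ) ≤ Nat.clog 2 n := by exact_mod_cast h1
  nlinarith

/-- **Existence of near-linear-size hypergraph spectral sparsifiers.** There is a universal
constant `C > 0` such that every weighted hypergraph `H = (V, E, w)` with `|V| = n ≥ 2`,
rank `r ≥ 2` and nonnegative weights admits, for every `ε ∈ (0,1)`, an `ε`-spectral
sparsifier with at most `C·n·log n·log r/ε²` hyperedges. -/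
theorem exists_hypergraph_spectral_sparsifier :
    ∃ C : ℝ, 0 < C ∧
      ∀ (n : ℕ), 2 ≤ n →
      ∀ (E : Finset (Finset (Fin n))) (w : Finset (Fin n) → ℝ),
      (∀ e ∈ E, 2 ≤ e.card) → (∀ e ∈ E, 0 ≤ w e) →
      ∀ r : ℕ, 2 ≤ r → E.sup Finset.card = r →
      ∀ ε : ℝ, 0 < ε → ε < 1 →
      ∃ tw : Finset (Fin n) → ℝ,
        (∀ e, 0 ≤ tw e) ∧ (∀ e, tw e ≠ 0 → e ∈ E) ∧
        ((E.filter (fun e => 0 < tw e)).card : ℝ)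
          ≤ C * n * Real.log n * Real.log r / ε ^ 2 ∧
        ∀ x : Fin n → ℝ, |QH E w x - QH E tw x| ≤ ε * QH E w x := by

  refine ⟨2 * (9 * 10 ^ 18 * 512), by positivity, fun n hn E w hE hw r hr2 hr ε hε hε1 => ?_⟩
  have hl := Real.log_two_gt_d9
  have hn2 : Real.log 2 ≤ Real.log n := Real.log_le_log two_pos (by exact_mod_cast hn)
  have hrl : Real.log 2 ≤ Real.log r := Real.log_le_log two_pos (by exact_mod_cast hr2)
  have hn0 : 0 < Real.log n := by linarith
  have hr0 : 0 < Real.log r := by linarith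
  set D := ε ^ 2 / (9 * 10 ^ 18 * 512 * (Real.log n * Real.log r)) with hD
  have hD0 : 0 < D := by positivity
  obtain ⟨K, hK⟩ := pow_unbounded_of_one_lt (E.card * D) one_lt_two
  have hKD : 2 ^ K * (D / 2 ^ K) = D := mul_div_cancel₀ _ (by positivity)
  have hn1 : (1 : ℝ) ≤ n := by exact_mod_cast (by omega : 1 ≤ n)
  have herr : 3 * 10 ^ 9 * Real.sqrt (2 ^ K * (D / 2 ^ K)) *
      (Real.sqrt (32 * Real.log r) * Real.sqrt (Nat.clog 2 n) + Real.sqrt (32 * Real.log n))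
        ≤ ε := by
    have h1 : Real.sqrt (32 * Real.log r) * Real.sqrt (Nat.clog 2 n)
        ≤ Real.sqrt (128 * (Real.log n * Real.log r)) := by
      rw [← Real.sqrt_mul (by positivity)]
      refine Real.sqrt_le_sqrt ?_
      nlinarith [clog_two_le_log hn]
    have h2 : Real.sqrt (32 * Real.log n) ≤ Real.sqrt (128 * (Real.log n * Real.log r)) :=
      Real.sqrt_le_sqrt (by nlinarith)
    have h3 : (3 * 10 ^ 9 * Real.sqrt D * (2 * Real.sqrt (128 * (Real.log n * Real.log r)))) ^ 2
        = ε ^ 2 := by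
      simp only [mul_pow]
      rw [Real.sq_sqrt hD0.le, Real.sq_sqrt (by positivity), hD]
      field_simp
      norm_num
    rw [hKD, ← (pow_left_inj₀ (by positivity) hε.le two_ne_zero).1 h3]
    gcongr
    linarith
  obtain ⟨tw, h0, hsupp, hcount, hle⟩ := exists_sparsifier_of_scale hn E w hE hw hr2
    (fun e he => hr ▸ Finset.le_sup (f := Finset.card) he) (δ := D / 2 ^ K) (by positivity)
    (by
      rw [← mul_div_assoc, div_le_iff₀ (by positivity)]
      nlinarith [pow_pos (two_pos (α := ℝ)) K])
    (Nat.clog_pos one_lt_two hn) (Nat.le_pow_clog one_lt_two n) K rfl (herr.trans hε1.le)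
  refine ⟨tw, h0, hsupp, ?_, fun x => (hle x).trans ?_⟩
  · rw [hKD, ← le_div_iff₀ hD0] at hcount
    refine hcount.trans_eq ?_
    rw [hD]
    field_simp
  · exact mul_le_mul_of_nonneg_right herr
      (Finset.sum_nonneg fun e he => mul_nonneg (hw e he) (Qe_nonneg _ _))
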